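/- arXiv:2112.04315 — 5 statements merged into one kernel-verified Lean document; each statement's English description precedes it below -/
import Mathlib

section
/- Let k be a field of characteristic different from 2 and let D be a quaternion division algebra over k, i.e., a central division algebra of degree 2 over k. Let K = k(x) be the rational function field in one variable over k. Then every central division algebra of degree 2 over K that has the same maximal subfields as D ⊗_k K is isomorphic to D ⊗_k K as a K-algebra. -/
open scoped TensorProduct

/-- `D` is a central division algebra of degree `n` over `k`: a division ring which is a
`k`-algebra whose center is exactly `k` and whose dimension over `k` is `n ^ 2`. -/
def IsCentralDivisionAlgebraOfDegree (k : Type) [Field k] (n : ℕ) (D : Type)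
    [DivisionRing D] [Algebra k D] : Prop :=
  Subalgebra.center k D = ⊥ ∧ Module.finrank k D = n ^ 2

/-- Two `k`-algebras have the same maximal subfields (relative to the degree `n`):
a field extension `P/k` of degree `n` embeds into one if and only if it embeds
into the other. -/
def HaveSameMaximalSubfields (k : Type) [Field k] (n : ℕ)
    (D₁ : Type) [Ring D₁] [Algebra k D₁] (D₂ : Type) [Ring D₂] [Algebra k D₂] : Prop :=
  ∀ (P : Type) [Field P] [Algebra k P], Module.finrank k P = n →
    (Nonempty (P →ₐ[k] D₁) ↔ Nonempty (P →ₐ[k] D₂))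

open Polynomial Quaternion

section DiagonalForms

variable {k : Type*} [Field k]

/-- The quaternary diagonal form with coefficients `α, β, γ, δ` is anisotropic over `R`. -/
def DiagAnisotropic {R : Type*} [CommRing R] (α β γ δ : R) : Prop :=
  ∀ s x y z : R, α * s ^ 2 + β * x ^ 2 + γ * y ^ 2 + δ * z ^ 2 = 0 → s = 0 ∧ x = 0 ∧ y = 0 ∧ z = 0

theorem DiagAnisotropic.natDegree_le {α β γ δ : k} (h : DiagAnisotropic α β γ δ)
    {S X Y Z : k[X]} {d : ℕ} (hS : S.natDegree ≤ d + 1) (hX : X.natDegree ≤ d + 1)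
    (hY : Y.natDegree ≤ d + 1) (hZ : Z.natDegree ≤ d + 1)
    (h0 : (C α * S ^ 2 + C β * X ^ 2 + C γ * Y ^ 2 + C δ * Z ^ 2).coeff (2 * (d + 1)) = 0) :
    S.natDegree ≤ d ∧ X.natDegree ≤ d ∧ Y.natDegree ≤ d ∧ Z.natDegree ≤ d := by
  simp only [coeff_add, coeff_C_mul, coeff_pow_of_natDegree_le hS, coeff_pow_of_natDegree_le hX,
    coeff_pow_of_natDegree_le hY, coeff_pow_of_natDegree_le hZ] at h0
  obtain ⟨h1, h2, h3, h4⟩ := h _ _ _ _ h0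
  have key : ∀ P : k[X], P.natDegree ≤ d + 1 → P.coeff (d + 1) = 0 → P.natDegree ≤ d := by
    intro P hP hc
    refine natDegree_le_iff_coeff_eq_zero.2 fun N hN => ?_
    rcases (Nat.succ_le_of_lt hN).eq_or_lt with rfl | hlt
    · exact hc
    · exact coeff_eq_zero_of_natDegree_lt (hP.trans_lt hlt)
  exact ⟨key _ hS h1, key _ hX h2, key _ hY h3, key _ hZ h4⟩

theorem DiagAnisotropic.polynomial {α β γ δ : k} (h : DiagAnisotropic α β γ δ) :
    DiagAnisotropic (C α) (C β) (C γ) (C δ) := by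
  intro S X Y Z h0
  have key : ∀ d : ℕ, S.natDegree ≤ d → X.natDegree ≤ d → Y.natDegree ≤ d → Z.natDegree ≤ d →
      S = 0 ∧ X = 0 ∧ Y = 0 ∧ Z = 0 := by
    intro d
    induction d with
    | zero =>
      intro hS hX hY hZ
      rw [eq_C_of_natDegree_le_zero hS, eq_C_of_natDegree_le_zero hX,
        eq_C_of_natDegree_le_zero hY, eq_C_of_natDegree_le_zero hZ] at h0 ⊢
      simp only [← C_mul, ← C_pow, ← C_add, C_eq_zero] at h0 ⊢
      exact h _ _ _ _ h0
    | succ d ih =>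
      intro hS hX hY hZ
      obtain ⟨h1, h2, h3, h4⟩ := h.natDegree_le hS hX hY hZ (by rw [h0, coeff_zero])
      exact ih h1 h2 h3 h4
  exact key (max (max S.natDegree X.natDegree) (max Y.natDegree Z.natDegree))
    (by simp) (by simp) (by simp) (by simp)

theorem degree_C_mul_sq_lt {R W : k[X]} (hRW : R.degree < W.degree) (c : k) :
    (C c * R ^ 2).degree < W.degree + W.degree := by
  have hW : W ≠ 0 := by rintro rfl; simp at hRW
  by_cases hR : R = 0
  · simp [hR, degree_eq_natDegree hW, ← WithBot.coe_natCast, ← WithBot.coe_add]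
  · have h1 := natDegree_lt_natDegree hR hRW
    have h2 : (C c * R ^ 2).natDegree ≤ 2 * R.natDegree :=
      (natDegree_C_mul_le _ _).trans natDegree_pow_le
    refine degree_le_natDegree.trans_lt ?_
    rw [degree_eq_natDegree hW]
    norm_cast
    omega

/-- The Cassels–Pfister theorem for ternary diagonal forms: an anisotropic form over `k` which
represents a polynomial `g` over `k(x)` represents it over `k[x]`. -/
theorem exists_polynomial_repr {α β γ : k} (h : DiagAnisotropic 1 α β γ) (g : k[X]) :
    ∀ (W X Y Z : k[X]), W ≠ 0 → C α * X ^ 2 + C β * Y ^ 2 + C γ * Z ^ 2 = g * W ^ 2 →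
    ∃ X Y Z : k[X], C α * X ^ 2 + C β * Y ^ 2 + C γ * Z ^ 2 = g := by
  intro W
  induction hn : W.natDegree using Nat.strong_induction_on generalizing W with
  | _ n ih =>
  intro X Y Z hW hXYZ
  have division : ∀ P : k[X], ∃ U R : k[X], W * U + R = P ∧ R.degree < W.degree := fun P =>
    ⟨P / W, P % W, EuclideanDomain.div_add_mod P W, EuclideanDomain.mod_lt P hW⟩
  obtain ⟨U₁, R₁, rfl, dX⟩ := division X
  obtain ⟨U₂, R₂, rfl, dY⟩ := division Y
  obtain ⟨U₃, R₃, rfl, dZ⟩ := division Z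
  obtain ⟨q, hq⟩ : ∃ q, q = C α * U₁ ^ 2 + C β * U₂ ^ 2 + C γ * U₃ ^ 2 := ⟨_, rfl⟩
  obtain ⟨B, hB⟩ : ∃ B, B = 2 * (C α * U₁ * R₁ + C β * U₂ * R₂ + C γ * U₃ * R₃) := ⟨_, rfl⟩
  obtain ⟨W', hW'⟩ : ∃ W', W' = W * (g - q) - B := ⟨_, rfl⟩
  have hR : C α * R₁ ^ 2 + C β * R₂ ^ 2 + C γ * R₃ ^ 2 = W * W' := by
    rw [hW', hB, hq]
    linear_combination hXYZ
  by_cases h0 : W' = 0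
  · obtain ⟨-, r1, r2, r3⟩ := h.polynomial 0 R₁ R₂ R₃ (by rw [h0] at hR; linear_combination hR)
    refine ⟨U₁, U₂, U₃, ?_⟩
    rw [r1, r2, r3] at hXYZ
    have : W ^ 2 ≠ 0 := pow_ne_zero _ hW
    apply mul_right_cancel₀ this
    linear_combination hXYZ
  · have hWW : W * W' ≠ 0 := mul_ne_zero hW h0
    have hdeg : (W * W').degree < W.degree + W.degree := by
      rw [← hR]
      exact (degree_add_le _ _).trans_lt (max_lt ((degree_add_le _ _).trans_lt (max_lt
        (degree_C_mul_sq_lt dX _) (degree_C_mul_sq_lt dY _))) (degree_C_mul_sq_lt dZ _))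
    have hlt : W'.natDegree < n := by
      rw [degree_eq_natDegree hWW, degree_eq_natDegree hW, natDegree_mul hW h0] at hdeg
      norm_cast at hdeg
      omega
    refine ih _ hlt W' rfl (W' * U₁ + (q - g) * R₁) (W' * U₂ + (q - g) * R₂)
      (W' * U₃ + (q - g) * R₃) h0 ?_
    linear_combination (-W' ^ 2) * hq + (q - g) ^ 2 * hR - W' * (q - g) * hB + W' * (q - g) * hW'

end DiagonalForms

section Residue

variable {k : Type*} [Field k]

theorem exists_dvd_sq_sub {p X W a : k[X]} (hp : Irreducible p) (hX : ¬ p ∣ X)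
    (h : p ∣ a * X ^ 2 - W ^ 2) : ∃ t, p ∣ t ^ 2 - a := by
  obtain ⟨u, v, huv⟩ := (hp.coprime_iff_not_dvd.2 hX).symm
  refine ⟨u * W, ?_⟩
  have e : (u * W) ^ 2 - a = -u ^ 2 * (a * X ^ 2 - W ^ 2) - p * (v * a * (u * X + 1)) := by
    linear_combination (a * (u * X + 1)) * huv
  rw [e]
  exact dvd_sub (h.mul_left _) (dvd_mul_right _ _)

theorem natDegree_lt_of_dvd_eq {p W W₁ : k[X]} (hp : Irreducible p) (hW : W ≠ 0)
    (h : W = p * W₁) : W₁ ≠ 0 ∧ W₁.natDegree < W.natDegree := by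
  subst h
  have h1 := right_ne_zero_of_mul hW
  refine ⟨h1, ?_⟩
  rw [natDegree_mul hp.ne_zero h1]
  have := hp.natDegree_pos
  omega

theorem exists_isotropic_mod {p h α β γ : k[X]} (hp : Irreducible p) (hh : ¬ p ∣ h) :
    ∀ W X Y Z : k[X], W ≠ 0 → α * X ^ 2 + β * Y ^ 2 + γ * Z ^ 2 = p * h * W ^ 2 →
    ∃ X Y Z : k[X], p ∣ α * X ^ 2 + β * Y ^ 2 + γ * Z ^ 2 ∧ ¬ (p ∣ X ∧ p ∣ Y ∧ p ∣ Z) := by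
  intro W
  induction hn : W.natDegree using Nat.strong_induction_on generalizing W with
  | _ n ih =>
  intro X Y Z hW e
  by_cases hd : p ∣ X ∧ p ∣ Y ∧ p ∣ Z
  · obtain ⟨⟨X, rfl⟩, ⟨Y, rfl⟩, ⟨Z, rfl⟩⟩ := hd
    have e1 : p * (α * X ^ 2 + β * Y ^ 2 + γ * Z ^ 2) = h * W ^ 2 :=
      mul_left_cancel₀ hp.ne_zero (by linear_combination e)
    obtain ⟨W₁, hW₁⟩ : p ∣ W :=
      hp.prime.dvd_of_dvd_pow ((hp.prime.dvd_or_dvd (Dvd.intro _ e1)).resolve_left hh)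
    obtain ⟨h1, h2⟩ := natDegree_lt_of_dvd_eq hp hW hW₁
    subst hW₁
    exact ih _ (hn ▸ h2) W₁ rfl X Y Z h1
      (mul_left_cancel₀ hp.ne_zero (by linear_combination e1))
  · exact ⟨X, Y, Z, e ▸ (dvd_mul_right p h).mul_right _, hd⟩

theorem exists_repr_one_of_isotropic {F : Type*} [Field F] (h2 : (2 : F) ≠ 0) {α β γ : F}
    (hα : α ≠ 0) (hβ : β ≠ 0) (hγ : γ ≠ 0) {x y z : F}
    (h : α * x ^ 2 + β * y ^ 2 + γ * z ^ 2 = 0) (hne : ¬ (x = 0 ∧ y = 0 ∧ z = 0)) :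
    ∃ x y z, α * x ^ 2 + β * y ^ 2 + γ * z ^ 2 = 1 := by
  by_cases hx : x = 0
  · by_cases hy : y = 0
    · have hz : z ≠ 0 := fun hz => hne ⟨hx, hy, hz⟩
      refine ⟨(1 - γ) / (2 * γ * z) * x, (1 - γ) / (2 * γ * z) * y,
        1 + (1 - γ) / (2 * γ * z) * z, ?_⟩
      field_simp
      linear_combination (1 - γ) ^ 2 * h
    · refine ⟨(1 - β) / (2 * β * y) * x, 1 + (1 - β) / (2 * β * y) * y,
        (1 - β) / (2 * β * y) * z, ?_⟩
      field_simp
      linear_combination (1 - β) ^ 2 * h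
  · refine ⟨1 + (1 - α) / (2 * α * x) * x, (1 - α) / (2 * α * x) * y,
        (1 - α) / (2 * α * x) * z, ?_⟩
    field_simp
    linear_combination (1 - α) ^ 2 * h

theorem exists_repr_one_mod (h2 : (2 : k) ≠ 0) {p : k[X]} (hp : Irreducible p) {α β γ : k}
    (hα : α ≠ 0) (hβ : β ≠ 0) (hγ : γ ≠ 0) {X Y Z : k[X]}
    (h : p ∣ C α * X ^ 2 + C β * Y ^ 2 + C γ * Z ^ 2) (hne : ¬ (p ∣ X ∧ p ∣ Y ∧ p ∣ Z)) :
    ∃ X Y Z : k[X], p ∣ C α * X ^ 2 + C β * Y ^ 2 + C γ * Z ^ 2 - 1 := by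
  have := Fact.mk hp
  have hC : ∀ c : k, c ≠ 0 → AdjoinRoot.mk p (C c) ≠ 0 := fun c hc =>
    (map_ne_zero (AdjoinRoot.of p)).2 hc
  have h2' : (2 : AdjoinRoot p) ≠ 0 := by simpa only [map_ofNat] using hC 2 h2
  rw [← AdjoinRoot.mk_eq_zero] at h
  simp only [← AdjoinRoot.mk_eq_zero] at hne
  simp only [map_add, map_mul, map_pow] at h
  obtain ⟨x, y, z, e⟩ := exists_repr_one_of_isotropic h2' (hC _ hα) (hC _ hβ) (hC _ hγ) h hne
  obtain ⟨X, rfl⟩ := AdjoinRoot.mk_surjective x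
  obtain ⟨Y, rfl⟩ := AdjoinRoot.mk_surjective y
  obtain ⟨Z, rfl⟩ := AdjoinRoot.mk_surjective z
  refine ⟨X, Y, Z, AdjoinRoot.mk_eq_zero.1 ?_⟩
  simp only [map_sub, map_add, map_mul, map_pow, e, map_one, sub_self]

theorem exists_dvd_sq_sub_of_repr {p h c : k[X]} {a : k} (ha : a ≠ 0) (hp : Irreducible p)
    (hh : ¬ p ∣ h) (hc : p ∣ c - 1) : ∀ W X Y Z : k[X], W ≠ 0 →
    C a * X ^ 2 + p * h * Y ^ 2 - C a * (p * h) * Z ^ 2 = c * W ^ 2 →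
    ∃ t : k[X], p ∣ t ^ 2 - C a := by
  intro W
  induction hn : W.natDegree using Nat.strong_induction_on generalizing W with
  | _ n ih =>
  intro X Y Z hW e
  have hpa : ¬ p ∣ C a := fun hd => hp.not_isUnit (isUnit_of_dvd_unit hd (by simpa using ha))
  by_cases hX : p ∣ X
  · have hpc : ¬ p ∣ c := fun hd => hp.not_isUnit (isUnit_of_dvd_one (by simpa using dvd_sub hd hc))
    obtain ⟨W₁, hW₁⟩ : p ∣ W := by
      have : p ∣ c * W ^ 2 := by
        rw [← e, show C a * X ^ 2 + p * h * Y ^ 2 - C a * (p * h) * Z ^ 2 =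
          X * (C a * X) + p * (h * Y ^ 2 - C a * h * Z ^ 2) by ring]
        exact dvd_add (hX.mul_right _) (dvd_mul_right _ _)
      exact hp.prime.dvd_of_dvd_pow ((hp.prime.dvd_or_dvd this).resolve_left hpc)
    obtain ⟨X, rfl⟩ := hX
    obtain ⟨h1, h2⟩ := natDegree_lt_of_dvd_eq hp hW hW₁
    subst hW₁
    have e1 : h * (Y ^ 2 - C a * Z ^ 2) = p * (c * W₁ ^ 2 - C a * X ^ 2) :=
      mul_left_cancel₀ hp.ne_zero (by linear_combination e)
    have hYZ : p ∣ Y ^ 2 - C a * Z ^ 2 :=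
      (hp.prime.dvd_or_dvd (Dvd.intro _ e1.symm)).resolve_left hh
    by_cases hZ : p ∣ Z
    · have hY : p ∣ Y := by
        refine hp.prime.dvd_of_dvd_pow (n := 2) ?_
        have := dvd_add hYZ ((hZ.mul_right Z).mul_left (C a))
        rwa [show Y ^ 2 - C a * Z ^ 2 + C a * (Z * Z) = Y ^ 2 by ring] at this
      obtain ⟨Z, rfl⟩ := hZ
      obtain ⟨Y, rfl⟩ := hY
      refine ih _ (hn ▸ h2) W₁ rfl X Y Z h1
        (mul_left_cancel₀ (pow_ne_zero 2 hp.ne_zero) (by linear_combination e))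
    · exact exists_dvd_sq_sub hp hZ (by rw [← dvd_neg]; simpa using hYZ)
  · refine exists_dvd_sq_sub hp hX (W := W) ?_
    obtain ⟨d, hd⟩ := hc
    refine ⟨d * W ^ 2 - h * Y ^ 2 + C a * h * Z ^ 2, ?_⟩
    linear_combination e + W ^ 2 * hd

/-- If `a` is not a square in `k` but a square modulo `p`, then `p` times a polynomial of smaller
degree is of the form `t ^ 2 - a`. -/
theorem exists_sq_sub_eq_mul {p : k[X]} {a : k} (ha : ¬ IsSquare a) (hp : Irreducible p)
    (h : ∃ t : k[X], p ∣ t ^ 2 - C a) :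
    ∃ t g : k[X], g ≠ 0 ∧ g.natDegree < p.natDegree ∧ t ^ 2 - C a = p * g := by
  obtain ⟨t, ht⟩ := h
  have e := EuclideanDomain.div_add_mod t p
  have hdeg : (t % p).degree < p.degree := EuclideanDomain.mod_lt t hp.ne_zero
  generalize t % p = r at e hdeg
  obtain ⟨g, hg⟩ : p ∣ r ^ 2 - C a := by
    have := dvd_sub ht (dvd_mul_right p (t / p * (t + r)))
    rwa [show t ^ 2 - C a - p * (t / p * (t + r)) = r ^ 2 - C a by
      linear_combination (-t - r) * e] at this
  have hg0 : g ≠ 0 := by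
    rintro rfl
    apply ha
    have h1 := congrArg (coeff · 0) hg
    simp only [coeff_sub, pow_two, mul_coeff_zero, coeff_C_zero, mul_zero, coeff_zero] at h1
    exact ⟨r.coeff 0, (sub_eq_zero.1 h1).symm⟩
  refine ⟨r, g, hg0, ?_, hg⟩
  have h1 : (p * g).natDegree ≤ 2 * r.natDegree := by
    rw [← hg, natDegree_sub_C]
    exact natDegree_pow_le
  rw [natDegree_mul hp.ne_zero hg0] at h1
  have h3 := hp.natDegree_pos
  have h4 : r.natDegree < p.natDegree := by
    by_cases hr : r = 0
    · simpa [hr] using h3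
    · exact natDegree_lt_natDegree hr hdeg
  omega

end Residue

section DivisionAlgebra

variable {K A : Type*} [Field K] [DivisionRing A] [Algebra K A]

theorem eq_zero_of_anticommute (h2 : (2 : K) ≠ 0) {i j : A} (hi : i ≠ 0) (hj : j ≠ 0)
    (hij : j * i = -(i * j)) {w x y z : K}
    (h : w • 1 + x • i + y • j + z • (i * j) = 0) : w = 0 ∧ x = 0 ∧ y = 0 ∧ z = 0 := by
  have h2' : (2 : A) ≠ 0 := by
    simpa only [map_ofNat] using (map_ne_zero (algebraMap K A)).2 h2
  have split : ∀ {u v r : A}, r ≠ 0 → (u + v) * r = 0 → r * u = u * r → r * v = -(v * r) →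
      u = 0 ∧ v = 0 := by
    intro u v r hr huv hu hv
    have h1 : u + v = 0 := (mul_eq_zero.1 huv).resolve_right hr
    have h3 : r * (u + v) = 0 := by rw [h1, mul_zero]
    rw [mul_add, hu, hv] at h3
    rw [add_mul] at huv
    have h4 : 2 * (u * r) = 0 := by
      rw [two_mul]
      calc u * r + u * r = (u * r + v * r) + (u * r + -(v * r)) := by abel
        _ = 0 := by rw [huv, h3, add_zero]
    have h5 : u = 0 :=
      (mul_eq_zero.1 ((mul_eq_zero.1 h4).resolve_left h2')).resolve_right hr
    exact ⟨h5, by simpa [h5] using h1⟩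
  have scalars : ∀ {s t : K}, s • 1 + t • i = 0 → s = 0 ∧ t = 0 := by
    intro s t hst
    obtain ⟨h3, h4⟩ := split (u := s • 1) (v := t • i) (r := j) hj
      (by rw [hst, zero_mul]) (by simp) (by simp [hij])
    exact ⟨(smul_eq_zero.1 h3).resolve_right one_ne_zero, (smul_eq_zero.1 h4).resolve_right hi⟩
  obtain ⟨h3, h4⟩ := split (u := w • 1 + x • i) (v := y • j + z • (i * j)) (r := i) hi
    (by rw [← add_assoc, h, zero_mul]) (by simp [mul_add, add_mul])
    (by simp [mul_add, add_mul, hij, mul_assoc, add_comm])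
  have h5 : (y • 1 + z • i) * j = 0 := by rw [← h4]; simp [add_mul]
  exact ⟨(scalars h3).1, (scalars h3).2, scalars ((mul_eq_zero.1 h5).resolve_right hj)⟩

theorem QuaternionAlgebra.Basis.injective_liftHom (h2 : (2 : K) ≠ 0) {a b : K} (ha : a ≠ 0)
    (hb : b ≠ 0) (q : QuaternionAlgebra.Basis A a 0 b) : Function.Injective q.liftHom := by
  rw [injective_iff_map_eq_zero]
  intro u hu
  have hi : q.i ≠ 0 := fun h => ha (by simpa [h] using q.i_mul_i.symm)
  have hj : q.j ≠ 0 := fun h => hb (by simpa [h] using q.j_mul_j.symm)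
  obtain ⟨h1, h3, h4, h5⟩ := eq_zero_of_anticommute h2 hi hj
    (by rw [q.j_mul_i, q.i_mul_j]; simp)
    (w := u.re) (x := u.imI) (y := u.imJ) (z := u.imK)
    (by rw [q.i_mul_j, ← Algebra.algebraMap_eq_smul_one]; exact hu)
  ext <;> assumption

theorem exists_quaternionBasis (h2 : (2 : K) ≠ 0) (hc : Subalgebra.center K A = ⊥)
    (hdim : Module.finrank K A = 4) {i : A} {a : K} (hii : i * i = algebraMap K A a)
    (hi : i ∉ (algebraMap K A).range) :
    ∃ (b : K) (q : QuaternionAlgebra.Basis A a 0 b), q.i = i ∧ b ≠ 0 := by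
  have mem_range : ∀ x : A, (∀ y, y * x = x * y) → x ∈ (algebraMap K A).range := by
    intro x hx
    have : x ∈ Subalgebra.center K A := Subalgebra.mem_center_iff.2 hx
    rw [hc] at this
    exact Algebra.mem_bot.1 this
  have hi0 : i ≠ 0 := fun h => hi (h ▸ zero_mem _)
  obtain ⟨z, hz⟩ : ∃ z, z * i ≠ i * z := by
    by_contra! h
    exact hi (mem_range i h)
  obtain ⟨j, hj⟩ : ∃ j, j = i * z - z * i := ⟨_, rfl⟩
  have hj0 : j ≠ 0 := by rw [hj]; exact sub_ne_zero.2 hz.symm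
  have hij : j * i = -(i * j) := by
    have e : i * i * z = z * (i * i) := by rw [hii, Algebra.commutes]
    rw [hj, sub_mul, mul_sub, ← mul_assoc i i z, e]
    simp only [mul_assoc]
    abel
  have hli : LinearIndependent K ![1, i, j, i * j] := by
    rw [Fintype.linearIndependent_iff]
    intro g hg
    simp only [Fin.sum_univ_four, Matrix.cons_val] at hg
    obtain ⟨h3, h4, h5, h6⟩ := eq_zero_of_anticommute h2 hi0 hj0 hij hg
    intro n
    fin_cases n <;> assumption
  have hspan := hli.span_eq_top_of_card_eq_finrank (by simp [hdim])
  have hijj : i * (j * j) = j * j * i := by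
    rw [mul_assoc, hij, mul_neg, ← mul_assoc j i j, hij, neg_mul, neg_neg, mul_assoc]
  obtain ⟨b, hb⟩ := mem_range (j * j) (fun y => by
    have hy : y ∈ Submodule.span K (Set.range ![1, i, j, i * j]) := hspan ▸ Submodule.mem_top
    induction hy using Submodule.span_induction with
    | mem x hx =>
      obtain ⟨n, rfl⟩ := hx
      fin_cases n
      · simp
      · exact hijj
      · exact (mul_assoc _ _ _).symm
      · change i * j * (j * j) = j * j * (i * j)
        rw [mul_assoc, ← mul_assoc j j j, ← mul_assoc (j * j) i j, ← hijj]
        simp only [mul_assoc]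
    | zero => simp
    | add x y _ _ hx hy => rw [add_mul, mul_add, hx, hy]
    | smul r x _ hx => rw [smul_mul_assoc, mul_smul_comm, hx])
  refine ⟨b, ⟨i, j, i * j, ?_, ?_, rfl, ?_⟩, rfl, ?_⟩
  · rw [hii, Algebra.algebraMap_eq_smul_one, zero_smul, add_zero]
  · rw [← hb, Algebra.algebraMap_eq_smul_one]
  · rw [hij, zero_smul, zero_sub]
  · rintro rfl
    rw [map_zero, zero_eq_mul_self] at hb
    exact hj0 hb

/-- A division algebra of dimension four which is not commutative contains a pure quaternion. -/
theorem exists_sq_eq_algebraMap (h2 : (2 : K) ≠ 0) (hc : Subalgebra.center K A = ⊥)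
    (hdim : Module.finrank K A = 4) :
    ∃ (a : K) (i : A), i * i = algebraMap K A a ∧ i ∉ (algebraMap K A).range := by
  have := NeZero.mk h2
  have : FiniteDimensional K A := Module.finite_of_finrank_pos (by omega)
  obtain ⟨z, hz⟩ : ∃ z : A, z ∉ (algebraMap K A).range := by
    by_contra! h
    have htop : (⊥ : Subalgebra K A) = ⊤ :=
      eq_top_iff.2 fun x _ => Algebra.mem_bot.2 (h x)
    have := Subalgebra.finrank_bot (F := K) (E := A)
    rw [htop, subalgebra_top_finrank_eq_submodule_top_finrank, finrank_top] at this
    omega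
  have hint : IsIntegral K z := Algebra.IsIntegral.isIntegral z
  have hirr := minpoly.irreducible hint
  have := Fact.mk hirr
  let φ : AdjoinRoot (minpoly K z) →ₐ[K] A :=
    Ideal.Quotient.liftₐ _ (aeval z) (fun p hp => by
      obtain ⟨r, rfl⟩ := Ideal.mem_span_singleton.1 hp
      simp)
  have hφ : φ (AdjoinRoot.root _) = z := by
    change aeval z X = z
    simp
  let : Module (AdjoinRoot (minpoly K z)) A := Module.compHom A (φ : _ →+* A)
  have : IsScalarTower K (AdjoinRoot (minpoly K z)) A := ⟨fun r x y => by
    change φ (r • x) * y = r • (φ x * y)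
    rw [map_smul, smul_mul_assoc]⟩
  have hmul := Module.finrank_mul_finrank K (AdjoinRoot (minpoly K z)) A
  have hdeg : Module.finrank K (AdjoinRoot (minpoly K z)) = (minpoly K z).natDegree :=
    (AdjoinRoot.powerBasis hirr.ne_zero).finrank
  have hpos := hirr.natDegree_pos
  have h1 : (minpoly K z).natDegree ≠ 1 := fun h => hz (minpoly.natDegree_eq_one_iff.1 h)
  have h4 : (minpoly K z).natDegree ≠ 4 := by
    intro h
    have := (AdjoinRoot.powerBasis hirr.ne_zero).finite
    have hsurj : Function.Surjective φ.toLinearMap :=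
      (LinearMap.injective_iff_surjective_of_finrank_eq_finrank (by rw [hdeg, h, hdim])).1
        φ.toRingHom.injective
    have : z ∈ Subalgebra.center K A := Subalgebra.mem_center_iff.2 fun y => by
      obtain ⟨y, rfl⟩ := hsurj y
      change φ y * z = z * φ y
      exact (congrArg (φ y * ·) hφ.symm).trans ((map_mul φ _ _).symm.trans
        ((congrArg φ (mul_comm _ _)).trans ((map_mul φ _ _).trans (congrArg (· * φ y) hφ))))
    rw [hc] at this
    exact hz (Algebra.mem_bot.1 this)
  have hd : (minpoly K z).natDegree = 2 := by
    rw [hdeg, hdim] at hmul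
    have hdvd := Dvd.intro _ hmul
    have := Nat.le_of_dvd (by norm_num) hdvd
    interval_cases (minpoly K z).natDegree <;> omega
  have hroot := minpoly.aeval K z
  rw [aeval_eq_sum_range, hd] at hroot
  have hlead : (minpoly K z).coeff 2 = 1 := by
    rw [← hd]; exact minpoly.monic hint
  simp only [Finset.sum_range_succ, Finset.sum_range_zero, hlead, pow_zero, pow_one, one_smul,
    zero_add] at hroot
  generalize (minpoly K z).coeff 0 = s at hroot
  generalize (minpoly K z).coeff 1 = t at hroot
  refine ⟨(t / 2) ^ 2 - s, z + algebraMap K A (t / 2), ?_, fun h => hz ?_⟩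
  · have ht : t • z = algebraMap K A (t / 2) * z + z * algebraMap K A (t / 2) := by
      rw [← Algebra.commutes, ← add_mul, ← map_add, add_halves, Algebra.smul_def]
    rw [ht, ← Algebra.algebraMap_eq_smul_one] at hroot
    rw [map_sub, map_pow, eq_sub_iff_add_eq, ← sub_eq_zero]
    rw [← hroot]
    noncomm_ring
  · have := sub_mem h (⟨t / 2, rfl⟩ : algebraMap K A (t / 2) ∈ (algebraMap K A).range)
    simpa using this

end DivisionAlgebra

section Descent

variable {k : Type*} [Field k]

theorem exists_natDegree_lt_of_repr (h2 : (2 : k) ≠ 0) {a b : k} (ha : a ≠ 0) (hb : b ≠ 0)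
    (hsq : ¬ IsSquare a) {f : k[X]} (hf : 0 < f.natDegree)
    (hfrepr : ∃ W X Y Z : k[X], W ≠ 0 ∧
      C a * X ^ 2 + C b * Y ^ 2 + C (-(a * b)) * Z ^ 2 = f * W ^ 2)
    (hrepr : ∀ X Y Z : k[X], C a * X ^ 2 + C b * Y ^ 2 + C (-(a * b)) * Z ^ 2 ≠ 0 →
      ∃ W X' Y' Z' : k[X], W ≠ 0 ∧ C a * X' ^ 2 + f * Y' ^ 2 + (-(C a * f)) * Z' ^ 2 =
        (C a * X ^ 2 + C b * Y ^ 2 + C (-(a * b)) * Z ^ 2) * W ^ 2) :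
    ∃ g W Y Z : k[X], g ≠ 0 ∧ g.natDegree < f.natDegree ∧ W ≠ 0 ∧
      g * W ^ 2 = f * (Y ^ 2 - C a * Z ^ 2) := by
  have hf0 : f ≠ 0 := by rintro rfl; simp at hf
  obtain ⟨p, hp, h, rfl⟩ := exists_irreducible_of_natDegree_pos hf
  have hh0 := right_ne_zero_of_mul hf0
  by_cases hh : p ∣ h
  · obtain ⟨g, rfl⟩ := hh
    have hg0 := right_ne_zero_of_mul hh0
    refine ⟨g, p, 1, 0, hg0, ?_, hp.ne_zero, by ring⟩
    rw [natDegree_mul hp.ne_zero hh0, natDegree_mul hp.ne_zero hg0]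
    have := hp.natDegree_pos
    omega
  · obtain ⟨W, X, Y, Z, hW, e⟩ := hfrepr
    obtain ⟨X, Y, Z, hd, hne⟩ := exists_isotropic_mod hp hh W X Y Z hW e
    obtain ⟨X, Y, Z, hc⟩ := exists_repr_one_mod h2 hp ha hb
      (neg_ne_zero.2 (mul_ne_zero ha hb)) hd hne
    obtain ⟨W, X', Y', Z', hW, e⟩ := hrepr X Y Z (fun h0 => hp.not_isUnit
      (isUnit_of_dvd_one (by rw [h0, zero_sub, dvd_neg] at hc; exact hc)))
    obtain ⟨t, g, hg0, hlt, hg⟩ := exists_sq_sub_eq_mul hsq hp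
      (exists_dvd_sq_sub_of_repr ha hp hh hc W X' Y' Z' hW (by linear_combination e))
    refine ⟨h * g, p, t, 1, mul_ne_zero hh0 hg0, ?_, hp.ne_zero, by
      linear_combination (-p * h) * hg⟩
    rw [natDegree_mul hp.ne_zero hh0, natDegree_mul hh0 hg0]
    omega

/-- If the anisotropic form with coefficients `α, β, γ` represents `u + v x ^ 2` over `k(x)`, then
over `k` it contains an orthogonal pair of vectors with values `u` and `v`. -/
theorem exists_orthogonal_pair_of_repr (h2 : (2 : k) ≠ 0) {α β γ u v : k}
    (h : DiagAnisotropic 1 α β γ) {W X' Y Z : k[X]} (hW : W ≠ 0)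
    (e : C α * X' ^ 2 + C β * Y ^ 2 + C γ * Z ^ 2 = (C u + C v * X ^ 2) * W ^ 2) :
    ∃ x₀ y₀ z₀ x₁ y₁ z₁ : k, α * x₀ ^ 2 + β * y₀ ^ 2 + γ * z₀ ^ 2 = u ∧
      α * x₁ ^ 2 + β * y₁ ^ 2 + γ * z₁ ^ 2 = v ∧ α * x₀ * x₁ + β * y₀ * y₁ + γ * z₀ * z₁ = 0 := by
  obtain ⟨P, Q, R, e⟩ := exists_polynomial_repr h _ W X' Y Z hW e
  have key : ∀ d : ℕ, P.natDegree ≤ d + 1 → Q.natDegree ≤ d + 1 → R.natDegree ≤ d + 1 →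
      P.natDegree ≤ 1 ∧ Q.natDegree ≤ 1 ∧ R.natDegree ≤ 1 := by
    intro d
    induction d with
    | zero => exact fun hP hQ hR => ⟨hP, hQ, hR⟩
    | succ d ih =>
      intro hP hQ hR
      obtain ⟨-, h1, h3, h4⟩ := h.natDegree_le (S := 0) (d := d + 1) (by simp) hP hQ hR (by
        rw [show C 1 * 0 ^ 2 + C α * P ^ 2 + C β * Q ^ 2 + C γ * R ^ 2 = C u + C v * X ^ 2 by
          rw [← e]; ring]
        refine coeff_eq_zero_of_natDegree_lt (lt_of_le_of_lt (b := 2) (by compute_degree) ?_)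
        omega)
      exact ih h1 h3 h4
  obtain ⟨hP, hQ, hR⟩ := key (max P.natDegree (max Q.natDegree R.natDegree))
    (by omega) (by omega) (by omega)
  rw [eq_X_add_C_of_natDegree_le_one hP, eq_X_add_C_of_natDegree_le_one hQ,
    eq_X_add_C_of_natDegree_le_one hR] at e
  generalize P.coeff 0 = x₀ at e
  generalize P.coeff 1 = x₁ at e
  generalize Q.coeff 0 = y₀ at e
  generalize Q.coeff 1 = y₁ at e
  generalize R.coeff 0 = z₀ at e
  generalize R.coeff 1 = z₁ at e
  have e' : C (α * x₁ ^ 2 + β * y₁ ^ 2 + γ * z₁ ^ 2 - v) * X ^ 2 +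
      C (2 * (α * x₀ * x₁ + β * y₀ * y₁ + γ * z₀ * z₁)) * X +
      C (α * x₀ ^ 2 + β * y₀ ^ 2 + γ * z₀ ^ 2 - u) = 0 := by
    simp only [map_add, map_sub, map_mul, map_pow, map_ofNat]
    linear_combination e
  have hcoeff := fun n => congrArg (coeff · n) e'
  have c0 := hcoeff 0
  have c1 := hcoeff 1
  have c2 := hcoeff 2
  simp [-map_add, -map_sub, -map_mul, -map_pow, coeff_X, coeff_C] at c0 c1 c2
  exact ⟨x₀, y₀, z₀, x₁, y₁, z₁, sub_eq_zero.1 c0, sub_eq_zero.1 c2, c1.resolve_left h2⟩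

end Descent

section QuaternionForms

variable {K A : Type*} [Field K]

theorem exists_repr_of_sq_eq (h2 : (2 : K) ≠ 0) {a b c : K} (hc : ¬ IsSquare c)
    {u : ℍ[K,a,0,b]} (hu : u * u = algebraMap K _ c) :
    ∃ x y z, a * x ^ 2 + b * y ^ 2 + -(a * b) * z ^ 2 = c := by
  have h0 := congrArg QuaternionAlgebra.re hu
  have h1 := congrArg QuaternionAlgebra.imI hu
  have h3 := congrArg QuaternionAlgebra.imJ hu
  have h4 := congrArg QuaternionAlgebra.imK hu
  simp [QuaternionAlgebra.coe_algebraMap] at h0 h1 h3 h4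
  refine ⟨u.imI, u.imJ, u.imK, ?_⟩
  by_cases hr : u.re = 0
  · rw [hr] at h0
    linear_combination h0
  · have hr2 := mul_ne_zero h2 hr
    have k1 : u.imI = 0 := (mul_eq_zero.1 (by linear_combination h1)).resolve_left hr2
    have k3 : u.imJ = 0 := (mul_eq_zero.1 (by linear_combination h3)).resolve_left hr2
    have k4 : u.imK = 0 := (mul_eq_zero.1 (by linear_combination h4)).resolve_left hr2
    rw [k1, k3, k4] at h0
    exact absurd ⟨u.re, by linear_combination -h0⟩ hc

theorem QuaternionAlgebra.Basis.sq_lift [Ring A] [Algebra K A] {a b : K}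
    (q : QuaternionAlgebra.Basis A a 0 b) (x y z : K) :
    q.liftHom ⟨0, x, y, z⟩ * q.liftHom ⟨0, x, y, z⟩ =
      algebraMap K A (a * x ^ 2 + b * y ^ 2 + -(a * b) * z ^ 2) := by
  rw [← map_mul, ← q.liftHom.commutes]
  generalize hc : a * x ^ 2 + b * y ^ 2 + -(a * b) * z ^ 2 = c
  congr 1
  ext
  · simp [QuaternionAlgebra.coe_algebraMap]
    linear_combination hc
  all_goals simp [QuaternionAlgebra.coe_algebraMap]; ring

theorem QuaternionAlgebra.Basis.diagAnisotropic [DivisionRing A] [Algebra K A]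
    (h2 : (2 : K) ≠ 0) {a b : K} (ha : a ≠ 0) (hb : b ≠ 0)
    (q : QuaternionAlgebra.Basis A a 0 b) : DiagAnisotropic 1 (-a) (-b) (a * b) := by
  intro s x y z h
  have hmul : q.liftHom ⟨s, x, y, z⟩ * q.liftHom ⟨s, -x, -y, -z⟩ = 0 := by
    rw [← map_mul, ← map_zero q.liftHom]
    congr 1
    ext
    · simp
      linear_combination h
    all_goals simp; ring
  have hinj := q.injective_liftHom h2 ha hb
  rcases mul_eq_zero.1 hmul with h0 | h0 <;> rw [map_eq_zero_iff _ hinj] at h0 <;>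
    simpa [QuaternionAlgebra.ext_iff] using h0

/-- Multiplying the second slot by a norm does not change a quaternion algebra. -/
theorem QuaternionAlgebra.Basis.exists_of_norm [Ring A] [Algebra K A] {a b b' w y z : K}
    (hw : w ≠ 0) (h : b' * w ^ 2 = b * (y ^ 2 - a * z ^ 2))
    (q : QuaternionAlgebra.Basis A a 0 b) : Nonempty (QuaternionAlgebra.Basis A a 0 b') := by
  have hb' : b' = b * ((y / w) ^ 2 - a * (z / w) ^ 2) := by
    field_simp
    linear_combination h
  subst hb'
  generalize y / w = y
  generalize z / w = z
  let q' : QuaternionAlgebra.Basis ℍ[K,a,0,b] a 0 (b * (y ^ 2 - a * z ^ 2)) :=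
    { i := ⟨0, 1, 0, 0⟩
      j := ⟨0, 0, y, z⟩
      k := ⟨0, 0, a * z, y⟩
      i_mul_i := by ext <;> simp
      j_mul_j := by ext <;> simp <;> ring
      i_mul_j := by ext <;> simp
      j_mul_i := by ext <;> simp }
  exact ⟨q'.compHom q.liftHom⟩

theorem QuaternionAlgebra.Basis.exists_of_orthogonal_pair [Ring A] [Algebra K A]
    {a b u v x₀ y₀ z₀ x₁ y₁ z₁ : K}
    (h₀ : -a * x₀ ^ 2 + -b * y₀ ^ 2 + a * b * z₀ ^ 2 = -v)
    (h₁ : -a * x₁ ^ 2 + -b * y₁ ^ 2 + a * b * z₁ ^ 2 = -u)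
    (h : -a * x₀ * x₁ + -b * y₀ * y₁ + a * b * z₀ * z₁ = 0)
    (q : QuaternionAlgebra.Basis A a 0 b) : Nonempty (QuaternionAlgebra.Basis A u 0 v) := by
  let q' : QuaternionAlgebra.Basis ℍ[K,a,0,b] u 0 v :=
    { i := ⟨0, x₁, y₁, z₁⟩
      j := ⟨0, x₀, y₀, z₀⟩
      k := ⟨0, x₁, y₁, z₁⟩ * ⟨0, x₀, y₀, z₀⟩
      i_mul_i := by
        ext
        · simp
          linear_combination -h₁
        all_goals simp; ring
      j_mul_j := by
        ext
        · simp
          linear_combination -h₀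
        all_goals simp; ring
      i_mul_j := rfl
      j_mul_i := by
        ext
        · simp
          linear_combination (-2) * h
        all_goals simp; ring }
  exact ⟨q'.compHom q.liftHom⟩

theorem QuaternionAlgebra.Basis.bijective_liftHom [DivisionRing A] [Algebra K A]
    (h2 : (2 : K) ≠ 0) {a b : K} (ha : a ≠ 0) (hb : b ≠ 0) (hdim : Module.finrank K A = 4)
    (q : QuaternionAlgebra.Basis A a 0 b) : Function.Bijective q.liftHom := by
  have : FiniteDimensional K A := Module.finite_of_finrank_pos (by omega)
  have hinj := q.injective_liftHom h2 ha hb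
  exact ⟨hinj, (LinearMap.injective_iff_surjective_of_finrank_eq_finrank
    (f := q.liftHom.toLinearMap) (by rw [QuaternionAlgebra.finrank_eq_four, hdim])).1 hinj⟩

end QuaternionForms

section BaseChange

theorem exists_baseChange_basis_bijective {k D : Type*} (K : Type*) [Field k] [Field K]
    [Algebra k K] [DivisionRing D] [Algebra k D] (h2 : (2 : k) ≠ 0) {a b : k} (ha : a ≠ 0)
    (hb : b ≠ 0) (hdim : Module.finrank k D = 4) (q : QuaternionAlgebra.Basis D a 0 b) :
    ∃ q' : QuaternionAlgebra.Basis (K ⊗[k] D) (algebraMap k K a) 0 (algebraMap k K b),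
      Function.Bijective q'.liftHom := by
  have : FiniteDimensional k D := Module.finite_of_finrank_pos (by omega)
  let ι : D →ₐ[k] K ⊗[k] D := Algebra.TensorProduct.includeRight
  let q' : QuaternionAlgebra.Basis (K ⊗[k] D) (algebraMap k K a) 0 (algebraMap k K b) :=
    { i := ι q.i
      j := ι q.j
      k := ι q.k
      i_mul_i := by rw [← map_mul, q.i_mul_i]; simp
      j_mul_j := by rw [← map_mul, q.j_mul_j]; simp
      i_mul_j := by rw [← map_mul, q.i_mul_j]
      j_mul_i := by rw [← map_mul, q.j_mul_i]; simp }
  have hsurj : Function.Surjective q'.liftHom := by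
    intro t
    induction t using TensorProduct.induction_on with
    | zero => exact ⟨0, map_zero _⟩
    | add x y hx hy =>
      obtain ⟨x, rfl⟩ := hx
      obtain ⟨y, rfl⟩ := hy
      exact ⟨x + y, map_add _ _ _⟩
    | tmul r d =>
      obtain ⟨u, rfl⟩ := (q.bijective_liftHom h2 ha hb hdim).2 d
      refine ⟨r • ⟨algebraMap k K u.re, algebraMap k K u.imI, algebraMap k K u.imJ,
        algebraMap k K u.imK⟩, ?_⟩
      have : r ⊗ₜ[k] q.liftHom u = r • ι (q.liftHom u) := by
        simp [ι, TensorProduct.smul_tmul']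
      rw [map_smul, this]
      congr 1
      simp [QuaternionAlgebra.Basis.lift, q', IsScalarTower.algebraMap_apply k K (K ⊗[k] D)]
  exact ⟨q', (LinearMap.injective_iff_surjective_of_finrank_eq_finrank
    (f := q'.liftHom.toLinearMap)
    (by rw [QuaternionAlgebra.finrank_eq_four, Module.finrank_baseChange, hdim])).2 hsurj, hsurj⟩

end BaseChange

section RationalFunctions

variable {k : Type*} [Field k]

theorem exists_common_denominator (x y z : RatFunc k) : ∃ W X Y Z : k[X], W ≠ 0 ∧
    algebraMap k[X] (RatFunc k) X = x * algebraMap _ _ W ∧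
    algebraMap k[X] (RatFunc k) Y = y * algebraMap _ _ W ∧
    algebraMap k[X] (RatFunc k) Z = z * algebraMap _ _ W := by
  have key : ∀ r : RatFunc k, ∃ N M : k[X], M ≠ 0 ∧
      algebraMap k[X] (RatFunc k) N = r * algebraMap _ _ M := fun r =>
    ⟨r.num, r.denom, r.denom_ne_zero, by
      rw [← div_eq_iff ((map_ne_zero_iff _ (RatFunc.algebraMap_injective k)).2 r.denom_ne_zero)]
      exact r.num_div_denom⟩
  obtain ⟨N₁, M₁, h₁, e₁⟩ := key x
  obtain ⟨N₂, M₂, h₂, e₂⟩ := key y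
  obtain ⟨N₃, M₃, h₃, e₃⟩ := key z
  refine ⟨M₁ * M₂ * M₃, N₁ * M₂ * M₃, N₂ * M₁ * M₃, N₃ * M₁ * M₂,
    mul_ne_zero (mul_ne_zero h₁ h₂) h₃, ?_, ?_, ?_⟩ <;> simp only [map_mul, e₁, e₂, e₃] <;> ring

theorem exists_polynomial_repr_of_ratFunc {α β γ g : k[X]} {x y z : RatFunc k}
    (h : algebraMap k[X] (RatFunc k) α * x ^ 2 + algebraMap k[X] (RatFunc k) β * y ^ 2 +
      algebraMap k[X] (RatFunc k) γ * z ^ 2 = algebraMap _ _ g) :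
    ∃ W X Y Z : k[X], W ≠ 0 ∧ α * X ^ 2 + β * Y ^ 2 + γ * Z ^ 2 = g * W ^ 2 := by
  obtain ⟨W, X, Y, Z, hW, hX, hY, hZ⟩ := exists_common_denominator x y z
  refine ⟨W, X, Y, Z, hW, RatFunc.algebraMap_injective k ?_⟩
  simp only [map_add, map_mul, map_pow, hX, hY, hZ, ← h]
  ring

theorem DiagAnisotropic.not_isSquare {α β γ : k} (h : DiagAnisotropic 1 (-α) (-β) (-γ))
    {X Y Z : k[X]} (hne : C α * X ^ 2 + C β * Y ^ 2 + C γ * Z ^ 2 ≠ 0) :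
    ¬ IsSquare (algebraMap k[X] (RatFunc k) (C α * X ^ 2 + C β * Y ^ 2 + C γ * Z ^ 2)) := by
  rintro ⟨s, hs⟩
  obtain ⟨W, S, -, -, hW, hS, -, -⟩ := exists_common_denominator s s s
  have e : S ^ 2 = (C α * X ^ 2 + C β * Y ^ 2 + C γ * Z ^ 2) * W ^ 2 := by
    apply RatFunc.algebraMap_injective k
    rw [map_mul, hs, map_pow, hS, map_pow]
    ring
  have h0 := (h.polynomial S (X * W) (Y * W) (Z * W) (by
    simp only [map_neg, map_one]
    linear_combination e)).1
  rw [h0] at e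
  exact mul_ne_zero hne (pow_ne_zero 2 hW) (by rw [← e]; ring)

theorem DiagAnisotropic.of_map {R S : Type*} [CommRing R] [CommRing S] {φ : R →+* S}
    (hφ : Function.Injective φ) {α β γ δ : R}
    (h : DiagAnisotropic (φ α) (φ β) (φ γ) (φ δ)) : DiagAnisotropic α β γ δ := by
  intro s x y z e
  have := h (φ s) (φ x) (φ y) (φ z) (by simp only [← map_pow, ← map_mul, ← map_add, e, map_zero])
  simpa only [map_eq_zero_iff φ hφ] using this

end RationalFunctions

theorem exists_sq_of_forall_quadratic {K A B : Type} [Field K] [Ring A] [Algebra K A] [Ring B]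
    [Algebra K B]
    (h : ∀ (P : Type) [Field P] [Algebra K P], Module.finrank K P = 2 →
      Nonempty (P →ₐ[K] A) → Nonempty (P →ₐ[K] B)) {c : K} (hc : ¬ IsSquare c)
    {u : A} (hu : u * u = algebraMap K A c) : ∃ v : B, v * v = algebraMap K B c := by
  have : Fact (∀ r : K, r ^ 2 ≠ c + 0 * r) :=
    ⟨fun r hr => hc ⟨r, by linear_combination -hr⟩⟩
  obtain ⟨φ⟩ := h (QuadraticAlgebra K c 0) (QuadraticAlgebra.finrank_eq_two _ _)
    ⟨QuadraticAlgebra.lift ⟨u, by simpa [Algebra.algebraMap_eq_smul_one] using hu⟩⟩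
  refine ⟨φ QuadraticAlgebra.omega, ?_⟩
  rw [← map_mul, ← φ.commutes, QuadraticAlgebra.omega_mul_omega_eq_mk]
  rfl

/-- If `Δ` contains the square root of every nonzero value taken on `k[x]` by the pure part of the
anisotropic norm form of `(a, b)`, and conversely the pure part of the form of `(a, b)` represents
over `k(x)` every nonsquare which is a square in `Δ`, then `Δ` is isomorphic to `(a, b)`. -/
theorem exists_quaternionBasis_of_same_squares {k : Type*} [Field k] (h2 : (2 : k) ≠ 0) {a b : k}
    (ha : a ≠ 0) (hb : b ≠ 0) (haniso : DiagAnisotropic 1 (-a) (-b) (a * b))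
    {Δ : Type*} [DivisionRing Δ] [Algebra (RatFunc k) Δ]
    (hc : Subalgebra.center (RatFunc k) Δ = ⊥) (hdim : Module.finrank (RatFunc k) Δ = 4)
    (hto : ∀ X Y Z : k[X], C a * X ^ 2 + C b * Y ^ 2 + C (-(a * b)) * Z ^ 2 ≠ 0 →
      ∃ u : Δ, u * u = algebraMap (RatFunc k) Δ (algebraMap k[X] (RatFunc k)
        (C a * X ^ 2 + C b * Y ^ 2 + C (-(a * b)) * Z ^ 2)))
    (hfrom : ∀ f : k[X], ¬ IsSquare (algebraMap k[X] (RatFunc k) f) →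
      (∃ u : Δ, u * u = algebraMap (RatFunc k) Δ (algebraMap k[X] (RatFunc k) f)) →
      ∃ W X Y Z : k[X], W ≠ 0 ∧ C a * X ^ 2 + C b * Y ^ 2 + C (-(a * b)) * Z ^ 2 = f * W ^ 2) :
    Nonempty (QuaternionAlgebra.Basis Δ (algebraMap k[X] (RatFunc k) (C a)) 0
      (algebraMap k[X] (RatFunc k) (C b))) := by
  have inj := RatFunc.algebraMap_injective k
  have h2K : (2 : RatFunc k) ≠ 0 := by
    simpa only [map_ofNat] using (map_ne_zero (algebraMap k (RatFunc k))).2 h2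
  have haK : algebraMap k[X] (RatFunc k) (C a) ≠ 0 := by
    rwa [map_ne_zero_iff _ inj, Ne, C_eq_zero]
  have haniso' : DiagAnisotropic 1 (-a) (-b) (-(-(a * b))) := by rwa [neg_neg]
  have hsq : ¬ IsSquare a := by
    rintro ⟨s, hs⟩
    have := (haniso s 1 0 0 (by linear_combination -hs)).2.1
    exact one_ne_zero this
  obtain ⟨i, hi⟩ := hto 1 0 0 (by simpa using ha)
  have hva := haniso'.not_isSquare (X := 1) (Y := 0) (Z := 0) (by simpa using ha)
  rw [show C a * 1 ^ 2 + C b * 0 ^ 2 + C (-(a * b)) * 0 ^ 2 = C a by ring] at hi hva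
  obtain ⟨f₀, q₀, -, hf₀⟩ := exists_quaternionBasis h2K hc hdim hi (by
    rintro ⟨s, rfl⟩
    rw [← map_mul] at hi
    exact hva ⟨s, ((algebraMap (RatFunc k) Δ).injective hi).symm⟩)
  have hex : ∃ n, ∃ f : k[X], f ≠ 0 ∧ f.natDegree = n ∧ Nonempty (QuaternionAlgebra.Basis Δ
      (algebraMap k[X] (RatFunc k) (C a)) 0 (algebraMap k[X] (RatFunc k) f)) := by
    obtain ⟨W, F, -, -, hW, hF, -, -⟩ := exists_common_denominator f₀ f₀ f₀
    have hWK : algebraMap k[X] (RatFunc k) W ≠ 0 := by rwa [map_ne_zero_iff _ inj]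
    refine ⟨_, F * W, mul_ne_zero ?_ hW, rfl, q₀.exists_of_norm (w := 1)
      (y := algebraMap k[X] (RatFunc k) W) (z := 0) one_ne_zero ?_⟩
    · rintro rfl
      rw [map_zero] at hF
      exact mul_ne_zero hf₀ hWK hF.symm
    · rw [map_mul, hF]
      ring
  classical
  obtain ⟨f, hf0, hfn, ⟨q⟩⟩ := Nat.find_spec hex
  have hfK : algebraMap k[X] (RatFunc k) f ≠ 0 := by rwa [map_ne_zero_iff _ inj]
  have hqaniso := q.diagAnisotropic h2K haK hfK
  have hbij := q.bijective_liftHom h2K haK hfK hdim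
  have hΔrepr : ∀ X Y Z : k[X], C a * X ^ 2 + C b * Y ^ 2 + C (-(a * b)) * Z ^ 2 ≠ 0 →
      ∃ W X' Y' Z' : k[X], W ≠ 0 ∧ C a * X' ^ 2 + f * Y' ^ 2 + (-(C a * f)) * Z' ^ 2 =
        (C a * X ^ 2 + C b * Y ^ 2 + C (-(a * b)) * Z ^ 2) * W ^ 2 := by
    intro X Y Z hne
    obtain ⟨u, hu⟩ := hto X Y Z hne
    obtain ⟨u, rfl⟩ := hbij.2 u
    rw [← map_mul, ← q.liftHom.commutes] at hu
    obtain ⟨x, y, z, e⟩ := exists_repr_of_sq_eq h2K (haniso'.not_isSquare hne) (hbij.1 hu)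
    exact exists_polynomial_repr_of_ratFunc (by rw [← e, map_neg, map_mul])
  have hdeg : f.natDegree = 0 := by
    by_contra hpos
    obtain ⟨W, X, Y, Z, hW, e⟩ := hfrom f (by
      rintro ⟨s, hs⟩
      have := (hqaniso s 0 1 0 (by linear_combination -hs)).2.2.1
      exact one_ne_zero this) ⟨q.j, by rw [q.j_mul_j, Algebra.smul_def, mul_one]⟩
    obtain ⟨g, W, Y, Z, hg0, hlt, hW, e⟩ := exists_natDegree_lt_of_repr h2 ha hb hsq
      (Nat.pos_of_ne_zero hpos) ⟨W, X, Y, Z, hW, e⟩ hΔrepr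
    refine Nat.find_min hex (hfn ▸ hlt) ⟨g, hg0, rfl, q.exists_of_norm
      ((map_ne_zero_iff _ inj).2 hW) (y := algebraMap k[X] (RatFunc k) Y)
      (z := algebraMap k[X] (RatFunc k) Z) ?_⟩
    simp only [← map_pow, ← map_mul, ← map_sub, e]
  obtain ⟨c, rfl⟩ : ∃ c, f = C c := ⟨_, eq_C_of_natDegree_eq_zero hdeg⟩
  have hcaniso : DiagAnisotropic 1 (-a) (-c) (a * c) := by
    apply DiagAnisotropic.of_map (φ := (algebraMap k[X] (RatFunc k)).comp C)
      (inj.comp C_injective)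
    simpa using hqaniso
  obtain ⟨W, X', Y', Z', hW, e⟩ := hΔrepr X 1 0 (by
    intro h0
    have := congrArg (coeff · 0) h0
    simp at this
    exact hb this)
  obtain ⟨x₀, y₀, z₀, x₁, y₁, z₁, e₀, e₁, e₂⟩ := exists_orthogonal_pair_of_repr h2 (u := -b)
    (v := -a) (X' := X') (Y := Y') (Z := Z') hcaniso hW (by
      simp only [map_neg, map_mul] at e ⊢
      linear_combination -e)
  let φ : k →+* RatFunc k := (algebraMap k[X] (RatFunc k)).comp C
  refine q.exists_of_orthogonal_pair (x₀ := φ x₀) (y₀ := φ y₀) (z₀ := φ z₀) (x₁ := φ x₁)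
    (y₁ := φ y₁) (z₁ := φ z₁) ?_ ?_ ?_
  · simpa [φ] using congrArg φ e₀
  · simpa [φ] using congrArg φ e₁
  · simpa [φ] using congrArg φ e₂

/-- The genus of a quaternion division algebra is killed by one purely transcendental variable:
over `K = k(x)` (`char k ≠ 2`), every central division algebra of degree `2` with the same
maximal subfields as `D ⊗_k K` is isomorphic to `D ⊗_k K`. -/
theorem quaternion_genus_trivial_over_rational_function_field
    (k : Type) [Field k] (hchar : ringChar k ≠ 2)
    (D : Type) [DivisionRing D] [Algebra k D]
    (hD : IsCentralDivisionAlgebraOfDegree k 2 D)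
    (Δ : Type) [DivisionRing Δ] [Algebra (RatFunc k) Δ]
    (hΔ : IsCentralDivisionAlgebraOfDegree (RatFunc k) 2 Δ)
    (hsame : HaveSameMaximalSubfields (RatFunc k) 2 Δ (RatFunc k ⊗[k] D)) :
    Nonempty (Δ ≃ₐ[RatFunc k] (RatFunc k ⊗[k] D)) := by
  have h2 : (2 : k) ≠ 0 := Ring.two_ne_zero hchar
  have h2K : (2 : RatFunc k) ≠ 0 := by
    simpa only [map_ofNat] using (map_ne_zero (algebraMap k (RatFunc k))).2 h2
  obtain ⟨a, i, hii, hi⟩ := exists_sq_eq_algebraMap h2 hD.1 hD.2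
  obtain ⟨b, q, -, hb⟩ := exists_quaternionBasis h2 hD.1 hD.2 hii hi
  have ha : a ≠ 0 := by
    rintro rfl
    rw [map_zero, mul_self_eq_zero] at hii
    exact hi (hii ▸ zero_mem _)
  have haniso := q.diagAnisotropic h2 ha hb
  obtain ⟨qK, hqK⟩ := exists_baseChange_basis_bijective (RatFunc k) h2 ha hb hD.2 q
  have hmap : ∀ c : k, algebraMap k (RatFunc k) c = algebraMap k[X] (RatFunc k) (C c) :=
    IsScalarTower.algebraMap_apply k k[X] (RatFunc k)
  have haK : algebraMap k (RatFunc k) a ≠ 0 := (_root_.map_ne_zero _).2 ha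
  have hbK : algebraMap k (RatFunc k) b ≠ 0 := (_root_.map_ne_zero _).2 hb
  obtain ⟨qΔ⟩ : Nonempty (QuaternionAlgebra.Basis Δ (algebraMap k (RatFunc k) a) 0
      (algebraMap k (RatFunc k) b)) := by
    rw [hmap a, hmap b]
    refine exists_quaternionBasis_of_same_squares h2 ha hb haniso hΔ.1 hΔ.2 ?_ ?_
    · intro X Y Z hne
      refine exists_sq_of_forall_quadratic (fun P _ _ hP => (hsame P hP).2)
        (DiagAnisotropic.not_isSquare (by rwa [neg_neg]) hne) (u := qK.liftHom ⟨0,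
          algebraMap k[X] (RatFunc k) X, algebraMap k[X] (RatFunc k) Y,
          algebraMap k[X] (RatFunc k) Z⟩) ?_
      rw [qK.sq_lift]
      congr 1
      simp only [hmap, map_add, map_mul, map_pow, map_neg]
    · rintro f hf ⟨u, hu⟩
      obtain ⟨v, hv⟩ := exists_sq_of_forall_quadratic (fun P _ _ hP => (hsame P hP).1) hf hu
      obtain ⟨v, rfl⟩ := hqK.2 v
      rw [← map_mul, ← qK.liftHom.commutes] at hv
      obtain ⟨x, y, z, e⟩ := exists_repr_of_sq_eq h2K hf (hqK.1 hv)
      exact exists_polynomial_repr_of_ratFunc (x := x) (y := y) (z := z)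
        (by simp only [← e, hmap, map_neg, map_mul])
  exact ⟨(AlgEquiv.ofBijective _ (qΔ.bijective_liftHom h2K haK hbK hΔ.2)).symm.trans
    (AlgEquiv.ofBijective _ hqK)⟩
end

section
/- Let n ≥ 1 and let the symmetric group S_n = Equiv.Perm (Fin n) act on ℤⁿ = (Fin n → ℤ) by permuting coordinates. Let M = { v ∈ ℤⁿ : ∑ᵢ v(i) = 0 } be the kernel of the augmentation map (the root lattice of type A_{n−1}), an S_n-invariant subgroup of ℤⁿ. Then the first group cohomology H¹(S_n, M) is isomorphic to ℤ/nℤ. -/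
open Equiv

/-- The group of 1-cocycles on `Sₙ` with values in the root lattice of type `A_{n-1}`,
i.e. in `M = {v ∈ ℤⁿ : ∑ᵢ v i = 0}`, for the permutation action `(σ • v) i = v (σ⁻¹ i)`. -/
def zOneA (n : ℕ) : AddSubgroup (Equiv.Perm (Fin n) → (Fin n → ℤ)) where
  carrier := {f | (∀ σ, ∑ i, f σ i = 0) ∧
    ∀ σ τ, f (σ * τ) = f σ + (f τ) ∘ ⇑σ⁻¹}
  zero_mem' := ⟨fun σ => by simp, fun σ τ => by funext i; simp⟩
  add_mem' := by
    rintro a b ⟨haS, ha⟩ ⟨hbS, hb⟩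
    refine ⟨fun σ => ?_, fun σ τ => ?_⟩
    · simp [Finset.sum_add_distrib, haS σ, hbS σ]
    · funext i
      simp only [Pi.add_apply, ha σ τ, hb σ τ, Function.comp_apply]
      ring
  neg_mem' := by
    rintro a ⟨haS, ha⟩
    refine ⟨fun σ => ?_, fun σ τ => ?_⟩
    · simp only [Pi.neg_apply, Finset.sum_neg_distrib, haS σ, neg_zero]
    · funext i
      simp only [Pi.neg_apply, Pi.add_apply, ha σ τ, Function.comp_apply]
      ring

/-- The group of 1-coboundaries on `Sₙ` with values in `M = {v ∈ ℤⁿ : ∑ᵢ v i = 0}`. -/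
def bOneA (n : ℕ) : AddSubgroup (Equiv.Perm (Fin n) → (Fin n → ℤ)) where
  carrier := {f | ∃ m : Fin n → ℤ, (∑ i, m i = 0) ∧ ∀ σ, f σ = m ∘ ⇑σ⁻¹ - m}
  zero_mem' := ⟨0, by simp, fun σ => by funext i; simp⟩
  add_mem' := by
    rintro a b ⟨m₁, hm₁, ha⟩ ⟨m₂, hm₂, hb⟩
    refine ⟨m₁ + m₂, by simp [Finset.sum_add_distrib, hm₁, hm₂], fun σ => ?_⟩
    funext i
    simp only [Pi.add_apply, ha σ, hb σ, Pi.sub_apply, Function.comp_apply]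
    ring
  neg_mem' := by
    rintro a ⟨m, hm, ha⟩
    refine ⟨-m, by simp only [Pi.neg_apply, Finset.sum_neg_distrib, hm, neg_zero], fun σ => ?_⟩
    funext i
    simp only [Pi.neg_apply, ha σ, Pi.sub_apply, Function.comp_apply]
    ring

/-- `H¹(Sₙ, M)` for `M = {v ∈ ℤⁿ : ∑ᵢ v i = 0}`: 1-cocycles modulo 1-coboundaries. -/
abbrev H1A (n : ℕ) : Type := zOneA n ⧸ (bOneA n).addSubgroupOf (zOneA n)

/-- A cocycle value at a point vanishes on the stabilizer of that point, since it restricts there to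
a homomorphism from a finite group to `ℤ`. -/
theorem apply_eq_zero_of_mem_zOneA_of_fixed {n : ℕ} {f : Equiv.Perm (Fin n) → (Fin n → ℤ)}
    (hf : f ∈ zOneA n) {κ : Equiv.Perm (Fin n)} {a : Fin n} (hκ : κ⁻¹ a = a) : f κ a = 0 := by
  have hone : f 1 a = 0 := by
    have h := congrFun (hf.2 1 1) a
    simp only [mul_one, Pi.add_apply, Function.comp_apply, inv_one, Equiv.Perm.one_apply] at h
    linarith
  have hpow (k : ℕ) : f (κ ^ k) a = k * f κ a := by
    induction k with
    | zero => simpa using hone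
    | succ k ih =>
      have h := congrFun (hf.2 κ (κ ^ k)) a
      simp only [Pi.add_apply, Function.comp_apply, hκ, ih] at h
      rw [pow_succ', h]
      push_cast
      ring
  have h := hpow (orderOf κ)
  rw [pow_orderOf_eq_one, hone] at h
  have hpos : (orderOf κ : ℤ) ≠ 0 := by exact_mod_cast (orderOf_pos κ).ne'
  exact (mul_eq_zero.mp h.symm).resolve_left hpos

/-- The value of a cocycle at `a` depends on the permutation only through the preimage of `a`. -/
theorem apply_eq_of_mem_zOneA_of_inv_apply_eq {n : ℕ} {f : Equiv.Perm (Fin n) → (Fin n → ℤ)}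
    (hf : f ∈ zOneA n) {σ ρ : Equiv.Perm (Fin n)} {a : Fin n} (h : σ⁻¹ a = ρ⁻¹ a) :
    f σ a = f ρ a := by
  have hκ : (σ * ρ⁻¹)⁻¹ a = a := by
    rw [mul_inv_rev, inv_inv, Equiv.Perm.mul_apply, h, ← Equiv.Perm.mul_apply, mul_inv_cancel,
      Equiv.Perm.one_apply]
  have hmul := congrFun (hf.2 (σ * ρ⁻¹) ρ) a
  rw [Pi.add_apply, Function.comp_apply, hκ, apply_eq_zero_of_mem_zOneA_of_fixed hf hκ,
    inv_mul_cancel_right, zero_add] at hmul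
  exact hmul

/-- The homomorphism sending `m ∈ ℤⁿ` to the cocycle `σ ↦ σ • m - m`, which has values in the root
lattice. -/
def coboundaryHom (n : ℕ) : (Fin n → ℤ) →+ zOneA n where
  toFun m := ⟨fun σ => m ∘ ⇑σ⁻¹ - m, fun σ => by
      simp only [Pi.sub_apply, Function.comp_apply, Finset.sum_sub_distrib]
      rw [Equiv.sum_comp σ⁻¹ m, sub_self],
    fun σ τ => by
      funext i
      simp [mul_inv_rev]⟩
  map_zero' := by
    ext σ i
    simp
  map_add' a b := by
    ext σ i
    simp
    ring

theorem coboundaryHom_apply {n : ℕ} (m : Fin n → ℤ) (σ : Equiv.Perm (Fin n)) :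
    (coboundaryHom n m : Equiv.Perm (Fin n) → (Fin n → ℤ)) σ = m ∘ ⇑σ⁻¹ - m := rfl

/-- Every cocycle becomes a coboundary in `ℤⁿ`. -/
theorem coboundaryHom_surjective {n : ℕ} (hn : 0 < n) :
    Function.Surjective (coboundaryHom n) := by
  rintro ⟨f, hf⟩
  let a : Fin n := ⟨0, hn⟩
  refine ⟨fun j => f (Equiv.swap a j) a, Subtype.ext (funext fun τ => funext fun i => ?_)⟩
  have hmul := congrFun (hf.2 (Equiv.swap a i) τ) a
  rw [Pi.add_apply, Function.comp_apply, Equiv.swap_inv, Equiv.swap_apply_left] at hmul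
  have hpre : f (Equiv.swap a (τ⁻¹ i)) a = f (Equiv.swap a i * τ) a :=
    apply_eq_of_mem_zOneA_of_inv_apply_eq hf (by simp [mul_inv_rev])
  rw [coboundaryHom_apply, Pi.sub_apply, Function.comp_apply, hpre, hmul]
  ring

/-- The coordinate sum modulo `n`. -/
def sumModHom (n : ℕ) : (Fin n → ℤ) →+ ZMod n where
  toFun m := ((∑ i, m i : ℤ) : ZMod n)
  map_zero' := by simp
  map_add' a b := by simp [Finset.sum_add_distrib]

theorem sumModHom_apply {n : ℕ} (m : Fin n → ℤ) :
    sumModHom n m = ((∑ i, m i : ℤ) : ZMod n) := rfl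

theorem sumModHom_surjective {n : ℕ} (hn : 0 < n) : Function.Surjective (sumModHom n) := by
  intro x
  obtain ⟨k, rfl⟩ := ZMod.intCast_surjective x
  exact ⟨Pi.single ⟨0, hn⟩ k, by rw [sumModHom_apply, Finset.sum_pi_single']; simp⟩

/-- The cocycle `σ ↦ σ • m - m` is a coboundary in the root lattice if and only if `n` divides the
coordinate sum of `m`. -/
theorem coboundaryHom_mem_bOneA_iff {n : ℕ} (hn : 0 < n) (m : Fin n → ℤ) :
    (coboundaryHom n m : Equiv.Perm (Fin n) → (Fin n → ℤ)) ∈ bOneA n ↔ sumModHom n m = 0 := by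
  rw [sumModHom_apply, ZMod.intCast_zmod_eq_zero_iff_dvd]
  constructor
  · rintro ⟨m', hm', h⟩
    let a : Fin n := ⟨0, hn⟩
    have hconst (i : Fin n) : m i = m' i + (m a - m' a) := by
      have hi := congrFun (h (Equiv.swap a i)) i
      simp only [coboundaryHom_apply, Pi.sub_apply, Function.comp_apply, Equiv.swap_inv,
        Equiv.swap_apply_right] at hi
      linarith
    refine ⟨m a - m' a, ?_⟩
    rw [Finset.sum_congr rfl fun i _ => hconst i, Finset.sum_add_distrib, hm', zero_add,
      Finset.sum_const, Finset.card_univ, Fintype.card_fin, nsmul_eq_mul]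
  · rintro ⟨c, hc⟩
    refine ⟨fun i => m i - c, by simp [Finset.sum_sub_distrib, hc], fun σ => ?_⟩
    funext i
    simp [coboundaryHom_apply]

/-- For the natural permutation action of `Sₙ` on `ℤⁿ` and the submodule
`M = {v : ∑ᵢ v i = 0}` (the root lattice of type `A_{n-1}`), one has
`H¹(Sₙ, M) ≅ ℤ/nℤ`. -/
theorem h1_perm_sum_zero_lattice (n : ℕ) (hn : 0 < n) :
    Nonempty (H1A n ≃+ ZMod n) := by
  let π : (Fin n → ℤ) →+ H1A n :=
    (QuotientAddGroup.mk' ((bOneA n).addSubgroupOf (zOneA n))).comp (coboundaryHom n)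
  have hπ : Function.Surjective π :=
    (QuotientAddGroup.mk'_surjective _).comp (coboundaryHom_surjective hn)
  have hker : π.ker = (sumModHom n).ker := by
    ext m
    rw [AddMonoidHom.mem_ker, AddMonoidHom.mem_ker, ← coboundaryHom_mem_bOneA_iff hn]
    exact QuotientAddGroup.eq_zero_iff _
  exact ⟨(QuotientAddGroup.quotientKerEquivOfSurjective π hπ).symm.trans
    ((QuotientAddGroup.quotientAddEquivOfEq hker).trans
      (QuotientAddGroup.quotientKerEquivOfSurjective (sumModHom n) (sumModHom_surjective hn)))⟩
end

section
/- Let n > 2 and let the symmetric group S_n = Equiv.Perm (Fin n) act on ℤⁿ = (Fin n → ℤ) by permuting coordinates. Let N = ℤⁿ / ℤ·(1,…,1) be the quotient of ℤⁿ by the diagonal copy of ℤ (the subgroup generated by the constant vector with all entries 1), with the induced S_n-action. Then the first group cohomology H¹(S_n, N) vanishes: H¹(S_n, N) = 0. -/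
/-- The diagonal copy of `ℤ` in `ℤⁿ`: the subgroup generated by the all-ones vector. -/
abbrev diagZ (n : ℕ) : AddSubgroup (Fin n → ℤ) := AddSubgroup.zmultiples 1

/-- `N = ℤⁿ / ℤ·(1,…,1)`. -/
abbrev NQuot (n : ℕ) : Type := (Fin n → ℤ) ⧸ diagZ n

/-- The action of a permutation `σ` on `ℤⁿ`, `(σ • v) i = v (σ⁻¹ i)`, as an additive
homomorphism. -/
def permCompHom (n : ℕ) (σ : Equiv.Perm (Fin n)) : (Fin n → ℤ) →+ (Fin n → ℤ) where
  toFun v := v ∘ ⇑σ⁻¹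
  map_zero' := rfl
  map_add' _ _ := rfl

/-- The induced action of a permutation `σ` on `N = ℤⁿ / ℤ·(1,…,1)`. -/
def permActN (n : ℕ) (σ : Equiv.Perm (Fin n)) : NQuot n →+ NQuot n :=
  QuotientAddGroup.map (diagZ n) (diagZ n) (permCompHom n σ) (by
    rintro x hx
    obtain ⟨z, hz⟩ := AddSubgroup.mem_zmultiples_iff.mp hx
    refine AddSubgroup.mem_comap.mpr (AddSubgroup.mem_zmultiples_iff.mpr ⟨z, ?_⟩)
    funext i
    simp [permCompHom, ← hz])

/-- The group of 1-cocycles on `Sₙ` with values in `N = ℤⁿ / ℤ·(1,…,1)`. -/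
def zOneN (n : ℕ) : AddSubgroup (Equiv.Perm (Fin n) → NQuot n) where
  carrier := {f | ∀ σ τ, f (σ * τ) = f σ + permActN n σ (f τ)}
  zero_mem' := fun σ τ => by simp
  add_mem' := by
    intro a b ha hb σ τ
    simp only [Pi.add_apply, ha σ τ, hb σ τ, map_add]
    abel
  neg_mem' := by
    intro a ha σ τ
    simp only [Pi.neg_apply, ha σ τ, map_neg]
    abel

/-- The group of 1-coboundaries on `Sₙ` with values in `N = ℤⁿ / ℤ·(1,…,1)`. -/
def bOneN (n : ℕ) : AddSubgroup (Equiv.Perm (Fin n) → NQuot n) where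
  carrier := {f | ∃ m : NQuot n, ∀ σ, f σ = permActN n σ m - m}
  zero_mem' := ⟨0, fun σ => by simp⟩
  add_mem' := by
    rintro a b ⟨m₁, ha⟩ ⟨m₂, hb⟩
    refine ⟨m₁ + m₂, fun σ => ?_⟩
    simp only [Pi.add_apply, ha σ, hb σ, map_add]
    abel
  neg_mem' := by
    rintro a ⟨m, ha⟩
    refine ⟨-m, fun σ => ?_⟩
    simp only [Pi.neg_apply, ha σ, map_neg]
    abel

/-- `H¹(Sₙ, N)`: 1-cocycles modulo 1-coboundaries. -/
abbrev H1N (n : ℕ) : Type := zOneN n ⧸ (bOneN n).addSubgroupOf (zOneN n)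

/-- Two integer vectors agree modulo the diagonal iff their coordinate differences agree. -/
theorem mk_diagZ_eq_iff {n : ℕ} (v w : Fin n → ℤ) :
    (QuotientAddGroup.mk v : NQuot n) = QuotientAddGroup.mk w ↔
      ∀ i j, v i - v j = w i - w j := by
  rw [QuotientAddGroup.eq, AddSubgroup.mem_zmultiples_iff]
  constructor
  · rintro ⟨z, hz⟩ i j
    have hi := congrFun hz i
    have hj := congrFun hz j
    simp at hi hj
    linarith
  · intro h
    rcases isEmpty_or_nonempty (Fin n) with _ | ⟨⟨i₀⟩⟩
    · exact ⟨0, Subsingleton.elim _ _⟩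
    · refine ⟨w i₀ - v i₀, funext fun i => ?_⟩
      have := h i i₀
      simp
      linarith

theorem permActN_mk {n : ℕ} (σ : Equiv.Perm (Fin n)) (v : Fin n → ℤ) :
    permActN n σ (QuotientAddGroup.mk v) = QuotientAddGroup.mk (v ∘ ⇑σ⁻¹) :=
  rfl

/-- A family of vectors indexed by permutations whose coordinate differences satisfy the
cocycle identity has the coordinate differences of a coboundary. -/
theorem exists_coboundary_of_sub_cocycle {α : Type*} [Fintype α] [DecidableEq α]
    (hα : 2 < Fintype.card α) (v : Equiv.Perm α → α → ℤ)
    (hv : ∀ σ τ i j, v (σ * τ) i - v (σ * τ) j =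
      (v σ i - v σ j) + (v τ (σ⁻¹ i) - v τ (σ⁻¹ j))) :
    ∃ m : α → ℤ, ∀ σ i j, v σ i - v σ j = (m (σ⁻¹ i) - m i) - (m (σ⁻¹ j) - m j) := by
  have h_one : ∀ i j, v 1 i - v 1 j = 0 := fun i j => by
    have := hv 1 1 i j
    simp at this
    linarith
  have h_even : ∀ i j, ∃ M : ℤ, v (Equiv.swap i j) i - v (Equiv.swap i j) j = -(2 * M) := by
    intro i j
    obtain ⟨k, hk⟩ : ∃ k, k ∉ ({i, j} : Finset α) := by
      by_contra! h
      have h_univ : ({i, j} : Finset α) = Finset.univ := Finset.eq_univ_of_forall h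
      have h_le := Finset.card_le_two (a := i) (b := j)
      rw [h_univ, Finset.card_univ] at h_le
      omega
    simp only [Finset.mem_insert, Finset.mem_singleton, not_or] at hk
    have h := hv (Equiv.swap i j) (Equiv.swap i j) i k
    simp only [Equiv.swap_mul_self, Equiv.swap_inv, Equiv.swap_apply_left,
      Equiv.swap_apply_of_ne_of_ne hk.1 hk.2, h_one] at h
    exact ⟨-(v (Equiv.swap i j) i - v (Equiv.swap i j) k), by linarith⟩
  choose M hM using h_even
  have h_anti : ∀ i j, M j i = -M i j := fun i j => by
    have h₁ := hM i j
    have h₂ := hM j i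
    rw [Equiv.swap_comm] at h₂
    linarith
  have h_equivariant : ∀ σ i j, v σ i - v σ j = M (σ⁻¹ i) (σ⁻¹ j) - M i j := by
    intro σ i j
    have h₁ := hv σ (Equiv.swap (σ⁻¹ i) (σ⁻¹ j)) i j
    have h₂ := hv (Equiv.swap i j) σ i j
    have h_conj : σ * Equiv.swap (σ⁻¹ i) (σ⁻¹ j) = Equiv.swap i j * σ := by
      rw [Equiv.mul_swap_eq_swap_mul]
      simp
    rw [h_conj, hM] at h₁
    rw [hM] at h₂
    simp only [Equiv.swap_inv, Equiv.swap_apply_left, Equiv.swap_apply_right] at h₂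
    linarith
  have h_add : ∀ i j k, M i j + M j k = M i k := by
    intro i j k
    by_cases hki : k = i
    · subst hki
      linarith [h_anti k j, h_anti k k]
    by_cases hkj : k = j
    · subst hkj
      linarith [h_anti k k]
    have h₁ := h_equivariant (Equiv.swap i j) i j
    have h₂ := h_equivariant (Equiv.swap i j) j k
    have h₃ := h_equivariant (Equiv.swap i j) i k
    simp only [Equiv.swap_inv, Equiv.swap_apply_left, Equiv.swap_apply_right,
      Equiv.swap_apply_of_ne_of_ne hki hkj] at h₁ h₂ h₃
    linarith [h_anti i j]
  obtain ⟨o⟩ : Nonempty α := Fintype.card_pos_iff.mp (by omega)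
  refine ⟨fun i => M i o, fun σ i j => ?_⟩
  rw [h_equivariant]
  linarith [h_add i j o, h_add (σ⁻¹ i) (σ⁻¹ j) o]

/-- For `n > 2`, the first cohomology of `Sₙ` with coefficients in
`N = ℤⁿ / ℤ·(1,…,1)` (the cocharacter lattice of a maximal torus of `PGLₙ`,
with the permutation action) vanishes. -/
theorem h1_perm_quotient_diagonal_eq_zero (n : ℕ) (hn : 2 < n) :
    ∀ x : H1N n, x = 0 := by
  intro x
  obtain ⟨⟨f, hf⟩, rfl⟩ := QuotientAddGroup.mk_surjective x
  rw [QuotientAddGroup.eq_zero_iff, AddSubgroup.mem_addSubgroupOf]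
  choose v hv using fun σ => QuotientAddGroup.mk_surjective (f σ)
  obtain ⟨m, hm⟩ := exists_coboundary_of_sub_cocycle (by simpa using hn) v
    (fun σ τ i j => by
      have h : f (σ * τ) = f σ + permActN n σ (f τ) := hf σ τ
      rw [← hv, ← hv, ← hv, permActN_mk, ← QuotientAddGroup.mk_add, mk_diagZ_eq_iff] at h
      rw [h i j]
      simp only [Pi.add_apply, Function.comp_apply]
      ring)
  refine ⟨QuotientAddGroup.mk m, fun σ => ?_⟩
  change f σ = _
  rw [← hv, permActN_mk, ← QuotientAddGroup.mk_sub, mk_diagZ_eq_iff]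
  exact hm σ
end

section
/- Let n be a positive integer with n ≠ 6, and let H be a subgroup of the symmetric group S_n = Equiv.Perm (Fin n) of index exactly n. Then H is the stabilizer of a point: there exists a ∈ Fin n such that H = { σ ∈ S_n : σ(a) = a }. In particular, S_n (n ≠ 6) has a single conjugacy class of subgroups of index n. -/
open Equiv MulAction
open scoped Pointwise

theorem Nat.lt_choose_of_two_le {n k : ℕ} (hk : 2 ≤ k) (hkn : k + 2 ≤ n) : n < n.choose k := by
  induction n generalizing k with
  | zero => omega
  | succ m ih =>
    obtain ⟨j, rfl⟩ : ∃ j, k = j + 1 := ⟨k - 1, by omega⟩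
    rw [Nat.choose_succ_succ']
    have h1 : 0 < m.choose j := Nat.choose_pos (by omega)
    by_cases h : j + 1 + 2 ≤ m
    · have := ih hk h
      omega
    · obtain ⟨i, rfl⟩ : ∃ i, j = i + 1 := ⟨j - 1, by omega⟩
      obtain rfl : m = i + 1 + 1 + 1 := by omega
      rw [Nat.choose_succ_self_right, Nat.choose_succ_succ', Nat.choose_succ_self_right]
      have : 0 < (i + 1 + 1).choose i := Nat.choose_pos (by omega)
      omega

namespace Equiv.Perm

theorem swap_mul_swap_pow_eq_one {α : Type*} [DecidableEq α] {a b c d : α}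
    (hab : a ≠ b) (hcd : c ≠ d) :
    (swap a b * swap c d) ^ 2 = 1 ∨ (swap a b * swap c d) ^ 3 = 1 := by
  by_cases h : (swap a b * swap c d) ^ 2 = 1
  · exact .inl h
  right
  ext x
  contrapose! h
  ext y
  simp only [pow_succ, pow_zero, one_mul, Perm.mul_apply, Perm.one_apply, swap_apply_def] at h ⊢
  grind

theorem exists_apply_eq_apply_comp {ι α : Type*} [Finite α] (x : ι → α)
    (hx : Function.Injective x) (p : Perm ι) : ∃ g : Perm α, ∀ i, g (x i) = x (p i) := by
  classical
  have : Finite ι := Finite.of_injective x hx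
  have := Fintype.ofFinite ι
  exact ⟨p.viaFintypeEmbedding ⟨x, hx⟩, fun i => p.viaFintypeEmbedding_apply_image ⟨x, hx⟩ i⟩

theorem conj_apply_eq {α : Type*} {σ g : Perm α} {x x' y y' : α} (hx : g x = x') (hy : g y = y')
    (hxy : σ x = y) : (g * σ * g⁻¹) x' = y' := by
  rw [← hx, ← hy, ← hxy]
  simp

theorem exists_mul_conj_pow_ne_one_of_fixed {α : Type*} [Finite α] {σ : Perm α} {a b c d e : α}
    (hnd : [a, b, c, d, e].Nodup) (ha : σ a = b) (hc : σ c = d)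
    (he : σ e = e) :
    ∃ g : Perm α, (σ * (g * σ * g⁻¹)) ^ 2 ≠ 1 ∧ (σ * (g * σ * g⁻¹)) ^ 3 ≠ 1 := by
  obtain ⟨g, hg⟩ := exists_apply_eq_apply_comp ![a, b, c, d, e]
    (by rw [← List.nodup_ofFn]; simpa using hnd) (finRotate 5)
  have ga : g a = b := hg 0
  have gb : g b = c := hg 1
  have gc : g c = d := hg 2
  have gd : g d = e := hg 3
  have ge : g e = a := hg 4
  have ta := conj_apply_eq ge ge he
  have tb := conj_apply_eq ga gb ha
  have td := conj_apply_eq gc gd hc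
  refine ⟨g, ?_⟩
  generalize g * σ * g⁻¹ = τ at *
  simp only [List.nodup_cons, List.mem_cons, not_or] at hnd
  refine ⟨fun h => ?_, fun h => ?_⟩
  all_goals
    replace h := congr($h a)
    simp only [pow_succ, pow_zero, one_mul, Perm.mul_apply, Perm.one_apply, ha, hc, he,
      ta, tb, td] at h
    grind

theorem exists_mul_conj_pow_ne_one_of_four_pairs {α : Type*} [Finite α] {σ : Perm α}
    {a b c d e f k l : α} (hnd : [a, b, c, d, e, f, k, l].Nodup) (hd : σ d = c)
    (hf : σ f = e) (hl : σ l = k) :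
    ∃ g : Perm α, (σ * (g * σ * g⁻¹)) ^ 2 ≠ 1 ∧ (σ * (g * σ * g⁻¹)) ^ 3 ≠ 1 := by
  obtain ⟨g, hg⟩ := exists_apply_eq_apply_comp ![a, b, c, d, e, f, k, l]
    (by rw [← List.nodup_ofFn]; simpa using hnd) (finRotate 8)
  have gc : g c = d := hg 2
  have gd : g d = e := hg 3
  have ge : g e = f := hg 4
  have gf : g f = k := hg 5
  have gk : g k = l := hg 6
  have gl : g l = a := hg 7
  have ta := conj_apply_eq gl gk hl
  have te := conj_apply_eq gd gc hd
  have tk := conj_apply_eq gf ge hf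
  refine ⟨g, ?_⟩
  generalize g * σ * g⁻¹ = τ at *
  simp only [List.nodup_cons, List.mem_cons, not_or] at hnd
  refine ⟨fun h => ?_, fun h => ?_⟩
  all_goals
    replace h := congr($h a)
    simp only [pow_succ, pow_zero, one_mul, Perm.mul_apply, Perm.one_apply, hd, hf, hl,
      ta, te, tk] at h
    grind

/-- An involution that is not a transposition has, outside degrees `4` and `6`, a conjugate
such that the product of the two has order larger than `3`. -/
theorem isSwap_of_forall_mul_conj_pow {α : Type*} [DecidableEq α] [Finite α]
    (h5 : 5 ≤ Nat.card α) (h6 : Nat.card α ≠ 6) {σ : Perm α} (hσ : σ ≠ 1)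
    (hinv : ∀ x, σ (σ x) = x)
    (h : ∀ g : Perm α, (σ * (g * σ * g⁻¹)) ^ 2 = 1 ∨ (σ * (g * σ * g⁻¹)) ^ 3 = 1) :
    σ.IsSwap := by
  have exists_notMem (l : List α) (hl : l.length < Nat.card α) : ∃ x, x ∉ l := by
    by_contra! hc
    have := Fintype.ofFinite α
    have h1 : (Finset.univ : Finset α) ⊆ l.toFinset := fun x _ => by simpa using hc x
    have h2 := (Finset.card_le_card h1).trans l.toFinset_card_le
    rw [Finset.card_univ, ← Nat.card_eq_fintype_card] at h2
    omega
  obtain ⟨a, ha⟩ : ∃ a, σ a ≠ a := by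
    by_contra! hc
    exact hσ (ext hc)
  obtain ⟨b, hb⟩ : ∃ b, σ a = b := ⟨_, rfl⟩
  have hb' : σ b = a := hb ▸ hinv a
  by_contra hns
  obtain ⟨c, hca, hcb, hc⟩ : ∃ c, c ≠ a ∧ c ≠ b ∧ σ c ≠ c := by
    by_contra! hc
    refine hns ⟨a, b, by grind, ext fun x => ?_⟩
    rw [swap_apply_def]
    grind
  obtain ⟨d, hd⟩ : ∃ d, σ c = d := ⟨_, rfl⟩
  have hd' : σ d = c := hd ▸ hinv c
  have hnd : [a, b, c, d].Nodup := by simp; grind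
  obtain ⟨g, hg⟩ :
      ∃ g : Perm α, (σ * (g * σ * g⁻¹)) ^ 2 ≠ 1 ∧ (σ * (g * σ * g⁻¹)) ^ 3 ≠ 1 := by
    by_cases hfix : ∃ e, σ e = e
    · obtain ⟨e, he⟩ := hfix
      exact exists_mul_conj_pow_ne_one_of_fixed (by simp; grind) hb hd he
    push Not at hfix
    obtain ⟨e, he⟩ := exists_notMem [a, b, c, d] (by simp; omega)
    obtain ⟨f, hf⟩ : ∃ f, σ e = f := ⟨_, rfl⟩
    have hf' : σ f = e := hf ▸ hinv e
    have hef := hfix e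
    have hnd' : [a, b, c, d, e, f].Nodup := by simp at hnd he ⊢; grind
    have hcard : 6 ≤ Nat.card α := by
      have := Fintype.ofFinite α
      rw [Nat.card_eq_fintype_card]
      exact hnd'.length_le_card
    obtain ⟨k, hk⟩ := exists_notMem [a, b, c, d, e, f] (by simp; omega)
    obtain ⟨l, hl⟩ : ∃ l, σ k = l := ⟨_, rfl⟩
    have hl' : σ l = k := hl ▸ hinv k
    have hkl := hfix k
    have hnd'' : [a, b, c, d, e, f, k, l].Nodup := by simp at hnd' hk ⊢; grind
    exact exists_mul_conj_pow_ne_one_of_four_pairs hnd'' hd' hf' hl'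
  exact (h g).elim hg.1 hg.2

/-- Outside degree `6`, isomorphisms of symmetric groups preserve transpositions. -/
theorem IsSwap.map_mulEquiv {α β : Type*} [DecidableEq α] [DecidableEq β] [Finite β]
    (h5 : 5 ≤ Nat.card β) (h6 : Nat.card β ≠ 6) (ψ : Perm α ≃* Perm β) {t : Perm α}
    (ht : t.IsSwap) : (ψ t).IsSwap := by
  obtain ⟨x, y, hxy, rfl⟩ := ht
  refine isSwap_of_forall_mul_conj_pow h5 h6 ?_ (fun z => ?_) (fun g => ?_)
  · rw [ne_eq, map_eq_one_iff ψ ψ.injective]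
    exact fun h => hxy (swap_eq_one_iff.mp h)
  · rw [← Perm.mul_apply, ← map_mul, swap_mul_self, map_one, Perm.one_apply]
  · obtain ⟨g, rfl⟩ := ψ.surjective g
    rw [← map_inv, ← map_mul, ← map_mul, ← map_mul, ← map_pow, ← map_pow,
      map_eq_one_iff ψ ψ.injective, map_eq_one_iff ψ ψ.injective, ← swap_apply_apply]
    exact swap_mul_swap_pow_eq_one hxy (g.injective.ne hxy)

theorem closure_isSwap_inter_stabilizer {α : Type*} [DecidableEq α] [Finite α] (a : α) :
    Subgroup.closure {t : Perm α | t.IsSwap ∧ t ∈ stabilizer (Perm α) a} =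
      stabilizer (Perm α) a := by
  refine le_antisymm ((Subgroup.closure_le _).mpr fun t ht => ht.2) fun f hf => ?_
  refine (mem_closure_isSwap fun t ht => ht.1).mpr ⟨Set.toFinite _, fun x => ?_⟩
  by_cases hx : f x = x
  · rw [hx]
    exact mem_orbit_self x
  have hfa : f a = a := hf
  have hxa : x ≠ a := by grind
  have hfxa : f x ≠ a := by grind [f.injective]
  refine ⟨⟨swap x (f x), Subgroup.subset_closure ⟨⟨x, f x, Ne.symm hx, rfl⟩, ?_⟩⟩,
    swap_apply_left x (f x)⟩
  exact swap_apply_of_ne_of_ne hxa.symm hfxa.symm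

/-- An intransitive subgroup of index `n` of the symmetric group of degree `n` is the stabilizer
of a point. -/
theorem eq_stabilizer_of_not_isPretransitive {α : Type*} [Finite α]
    (H : Subgroup (Perm α)) (hH : H.index = Nat.card α) (hH' : ¬ IsPretransitive H α) :
    ∃ a : α, H = stabilizer (Perm α) a := by
  classical
  have := Fintype.ofFinite α
  suffices ∃ a : α, H ≤ stabilizer (Perm α) a by
    obtain ⟨a, ha⟩ := this
    refine ⟨a, le_antisymm ha (Subgroup.relIndex_eq_one.mp ?_)⟩
    have h1 := Subgroup.relIndex_mul_index ha
    rw [index_stabilizer_of_transitive, hH] at h1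
    exact Nat.eq_of_mul_eq_mul_right (Nat.card_pos_iff.mpr ⟨⟨a⟩, inferInstance⟩)
      (h1.trans (one_mul _).symm)
  obtain ⟨x, y, hxy⟩ : ∃ x y : α, y ∉ orbit H x := by
    by_contra! hc
    exact hH' ⟨fun x y => hc x y⟩
  let s : Finset α := (orbit H x).toFinset
  have mem_s {z : α} : z ∈ s ↔ z ∈ orbit H x := Set.mem_toFinset
  have hs : ∀ h ∈ H, ∀ z, h z ∈ s ↔ z ∈ s := fun h hh z => by
    rw [mem_s, mem_s]
    rw [← orbit_eq_iff, ← orbit_eq_iff, ← orbit_smul (⟨h, hh⟩ : H) z]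
    rfl
  let S : Set.powersetCard α s.card := ⟨s, rfl⟩
  have hle : H ≤ stabilizer (Perm α) S := fun h hh => by
    refine Subtype.ext (Finset.coe_injective ?_)
    ext z
    simpa [S, Set.mem_smul_set_iff_inv_smul_mem] using hs _ (inv_mem hh) z
  have hindex := Subgroup.index_dvd_of_le hle
  have := Set.powersetCard.isPretransitive (α := α) (n := s.card)
  rw [index_stabilizer_of_transitive, Set.powersetCard.card, hH] at hindex
  have hchoose := Nat.le_of_dvd (Nat.card_pos_iff.mpr ⟨⟨x⟩, inferInstance⟩) hindex
  have hpos : 0 < s.card := Finset.card_pos.mpr ⟨x, mem_s.mpr (mem_orbit_self x)⟩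
  have hlt : 0 < sᶜ.card := Finset.card_pos.mpr ⟨y, by simpa [mem_s] using hxy⟩
  have hadd := s.card_add_card_compl
  rw [← Nat.card_eq_fintype_card] at hadd
  have hor : s.card = 1 ∨ sᶜ.card = 1 := by
    by_contra! hc
    have := Nat.lt_choose_of_two_le (n := Nat.card α) (k := s.card) (by omega) (by omega)
    omega
  rcases hor with h1 | h1
  · obtain ⟨a, ha⟩ := Finset.card_eq_one.mp h1
    exact ⟨a, fun h hh => by simpa [ha] using hs h hh a⟩
  · obtain ⟨a, ha⟩ := Finset.card_eq_one.mp h1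
    refine ⟨a, fun h hh => ?_⟩
    have h2 := not_congr (hs h hh a)
    rw [← Finset.mem_compl, ← Finset.mem_compl, ha] at h2
    simpa using h2

theorem normalCore_eq_bot_of_two_lt_index {α : Type*} [Finite α] (h5 : 5 ≤ Nat.card α)
    {H : Subgroup (Perm α)} (hH : 2 < H.index) : H.normalCore = ⊥ := by
  classical
  have := Fintype.ofFinite α
  have : Nontrivial α := Finite.one_lt_card_iff_nontrivial.mp (by omega)
  by_contra hbot
  have hle := (alternatingGroup_le_of_normal h5
    ((Subgroup.nontrivial_iff_ne_bot _).mpr hbot)).trans H.normalCore_le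
  have := Nat.le_of_dvd (by simp [alternatingGroup.index_eq_two]) (Subgroup.index_dvd_of_le hle)
  rw [alternatingGroup.index_eq_two] at this
  omega

end Equiv.Perm

/-- For `n ≠ 6`, every subgroup of index `n` in the symmetric group `Sₙ` is the stabilizer
of a point; in particular `Sₙ` has a single conjugacy class of subgroups of index `n`. -/
theorem subgroup_of_index_n_is_stabilizer (n : ℕ) (hn : 0 < n) (h6 : n ≠ 6)
    (H : Subgroup (Equiv.Perm (Fin n))) (hH : H.index = n) :
    ∃ a : Fin n, H = MulAction.stabilizer (Equiv.Perm (Fin n)) a := by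
  classical
  obtain rfl | hn1 : n = 1 ∨ 2 ≤ n := by omega
  · exact ⟨0, Subsingleton.elim _ _⟩
  refine Perm.eq_stabilizer_of_not_isPretransitive H (by simpa using hH) fun htrans => ?_
  rcases Nat.lt_or_ge n 5 with h5 | h5
  · have h1 := H.card_mul_index
    have h2 : n ∣ Nat.card H := by
      have := (stabilizer H (⟨0, hn⟩ : Fin n)).index_dvd_card
      rwa [index_stabilizer_of_transitive, Nat.card_fin] at this
    obtain ⟨k, hk⟩ := h2
    rw [hH, Nat.card_perm, Nat.card_fin, hk] at h1
    interval_cases n <;> simp [Nat.factorial] at h1 <;> omega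
  · have hcard : Nat.card (Perm (Fin n) ⧸ H) = n := hH
    have hinj : Function.Injective (toPermHom (Perm (Fin n)) (Perm (Fin n) ⧸ H)) := by
      rw [← MonoidHom.ker_eq_bot_iff, ← Subgroup.normalCore_eq_ker]
      exact Perm.normalCore_eq_bot_of_two_lt_index (by simpa) (by omega)
    let φ := MulEquiv.ofBijective (toPermHom (Perm (Fin n)) (Perm (Fin n) ⧸ H))
      ((Nat.bijective_iff_injective_and_card _).mpr
        ⟨hinj, by rw [Nat.card_perm, Nat.card_perm, hcard, Nat.card_fin]⟩)
    let q : Perm (Fin n) ⧸ H := ((1 : Perm (Fin n)) : Perm (Fin n) ⧸ H)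
    have hmap : H = (stabilizer (Perm (Perm (Fin n) ⧸ H)) q).map (φ.symm : _ →* _) := by
      rw [Subgroup.map_equiv_eq_comap_symm]
      exact (stabilizer_quotient H).symm
    rw [← Perm.closure_isSwap_inter_stabilizer, MonoidHom.map_closure] at hmap
    rw [hmap] at htrans
    have hswap : ∀ t ∈ Set.image (φ.symm : _ →* Perm (Fin n))
        {t : Perm (Perm (Fin n) ⧸ H) | t.IsSwap ∧ t ∈ stabilizer _ q}, t.IsSwap := by
      rintro _ ⟨t, ht, rfl⟩
      exact ht.1.map_mulEquiv (by simpa) (by simpa) φ.symm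
    have htop := closure_of_isSwap_of_isPretransitive hswap
    rw [← hmap] at htop
    rw [htop, Subgroup.index_top] at hH
    omega
end

section
/- Let n be a positive integer, G = S_n = Equiv.Perm (Fin n), and let H₁, H₂ ≤ G be subgroups of index exactly n. If the rational permutation representations of G on the coset spaces G/H₁ and G/H₂ are isomorphic — i.e., the ℚ-linear representations of G on the free ℚ-vector spaces with bases G/H₁ and G/H₂ (with G acting by permuting cosets by left translation) are isomorphic as representations of G — then H₁ and H₂ are conjugate in G: there exists g ∈ G with H₂ = g H₁ g⁻¹. -/
open MulAction Equiv.Perm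
open scoped Pointwise Nat

theorem Nat.add_lt_choose_add {a b : ℕ} (ha : 2 ≤ a) (hb : 2 ≤ b) : a + b < (a + b).choose a := by
  have le_choose : ∀ a b : ℕ, a + 1 + (b + 1) ≤ (a + 1 + (b + 1)).choose (a + 1) := by
    intro a
    induction a with
    | zero => intro b; simp
    | succ a iha =>
      intro b
      induction b with
      | zero => simp [Nat.choose_succ_self_right]
      | succ b ihb =>
        have h := Nat.choose_succ_succ (a + 1 + (b + 1 + 1)) (a + 1)
        have h1 := iha (b + 1)
        rw [show a + 1 + 1 + (b + 1) = a + 1 + (b + 1 + 1) by ring] at ihb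
        rw [show a + 1 + 1 + (b + 1 + 1) = (a + 1 + (b + 1 + 1)).succ by omega]
        simp only [Nat.succ_eq_add_one] at h ⊢
        omega
  obtain ⟨a, rfl⟩ := Nat.exists_eq_add_of_le' ha
  obtain ⟨b, rfl⟩ := Nat.exists_eq_add_of_le' hb
  have h := Nat.choose_succ_succ (a + 1 + (b + 1 + 1)) (a + 1)
  have h1 := le_choose a (b + 1)
  have h2 := le_choose (a + 1) b
  rw [show a + 1 + 1 + (b + 1) = a + 1 + (b + 1 + 1) by ring] at h2
  rw [show a + 2 + (b + 2) = (a + 1 + (b + 1 + 1)).succ by omega]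
  simp only [Nat.succ_eq_add_one] at h ⊢
  rw [show a + 2 = a + 1 + 1 from rfl]
  omega

/-- If `ℚ[G/H] ≅ ℚ[X]` with `H` proper, then `H` does not act transitively on `X`. -/
theorem exists_stable_set_of_iso {G X : Type} [Group G] [MulAction G X] {H : Subgroup G}
    (hH : H ≠ ⊤) (e : Rep.ofMulAction ℚ G (G ⧸ H) ≅ Rep.ofMulAction ℚ G X) :
    ∃ S : Set X, S.Nonempty ∧ Sᶜ.Nonempty ∧ ∀ h ∈ H, h • S = S := by
  let u : MonoidAlgebra ℚ (G ⧸ H) := MonoidAlgebra.single ((1 : G) : G ⧸ H) 1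
  let v : MonoidAlgebra ℚ X := e.hom.hom u
  have map_u (g : G) : e.hom.hom (Representation.ofMulAction ℚ G (G ⧸ H) g u) =
      Representation.ofMulAction ℚ G X g v := (Rep.Hom.hom e.hom).isIntertwining _ _ g u
  have mem_iff (g : G) : Representation.ofMulAction ℚ G X g v = v ↔ g ∈ H := by
    have hinj : Function.Injective e.hom.hom := fun a b hab => by
      have := congrArg e.inv.hom hab
      simpa using this
    rw [← map_u, hinj.eq_iff, Representation.ofMulAction_single,
      MonoidAlgebra.single_left_inj one_ne_zero, MulAction.Quotient.smul_coe, eq_comm,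
      QuotientGroup.eq]
    simp
  obtain ⟨g, -, hg⟩ := SetLike.exists_of_lt hH.lt_top
  obtain ⟨x, y, hxy⟩ : ∃ x y, v.coeff x ≠ v.coeff y := by
    by_contra! hconst
    refine hg ((mem_iff g).1 ?_)
    ext x
    rw [Representation.coeff_ofMulAction]
    exact hconst _ _
  refine ⟨{z | v.coeff z = v.coeff x}, ⟨x, rfl⟩, ⟨y, Ne.symm hxy⟩, fun h hh => ?_⟩
  ext z
  have := congrArg (fun w => w.coeff z) ((mem_iff h).2 hh)
  simp only [Representation.coeff_ofMulAction] at this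
  simp [Set.mem_smul_set_iff_inv_smul_mem, this]

theorem normalCore_eq_bot_of_index_eq {n : ℕ} {H : Subgroup (Equiv.Perm (Fin n))}
    (hH : H.index = n) : H.normalCore = ⊥ := by
  by_contra hbot
  have hcard : Nat.card H * n = n ! := by
    calc Nat.card H * n = Nat.card H * H.index := by rw [hH]
      _ = n ! := by rw [H.card_mul_index, Nat.card_perm, Nat.card_fin]
  have hdvd : Nat.card H.normalCore ∣ Nat.card H := Subgroup.card_dvd_of_le H.normalCore_le
  rcases le_or_gt 5 n with h5 | h5
  · have hle : alternatingGroup (Fin n) ≤ H :=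
      (alternatingGroup_le_of_normal (by simpa using h5)
        ((Subgroup.nontrivial_iff_ne_bot _).2 hbot)).trans H.normalCore_le
    have : Nontrivial (Fin n) := Fin.nontrivial_iff_two_le.2 (by omega)
    have := Nat.le_of_dvd (by simp [alternatingGroup.index_eq_two]) (Subgroup.index_dvd_of_le hle)
    rw [hH, alternatingGroup.index_eq_two] at this
    omega
  have conj_card_le (g : Equiv.Perm (Fin n)) (hg : g ∈ H.normalCore) :
      (insert 1 (Finset.univ.image fun a => a * g * a⁻¹)).card ≤ Nat.card H.normalCore := by
    rw [← SetLike.coe_sort_coe, Nat.card_coe_set_eq, ← Set.ncard_coe_finset]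
    refine Set.ncard_le_ncard (fun x hx => ?_) (Set.toFinite _)
    simp only [Finset.coe_insert, Finset.coe_image, Finset.coe_univ, Set.image_univ,
      Set.mem_insert_iff, Set.mem_range] at hx
    rcases hx with rfl | ⟨a, rfl⟩
    · exact one_mem _
    · exact H.normalCore_normal.conj_mem g hg a
  obtain ⟨g, hg, hg1⟩ := (Subgroup.bot_or_exists_ne_one H.normalCore).resolve_left hbot
  have hone : Nat.card H = 1 → False := fun h => hg1 <| by
    rw [Subgroup.card_eq_one.1 h] at hg
    simpa using Subgroup.normalCore_le _ hg
  interval_cases n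
  · simp at hcard
  · exact hone (by simp)
  · exact hone (by simpa using hcard)
  · have hlow : ∀ g : Equiv.Perm (Fin 3), g ≠ 1 →
        3 ≤ (insert 1 (Finset.univ.image fun a => a * g * a⁻¹)).card := by decide +kernel
    have hH2 : Nat.card H = 2 := by simp [Nat.factorial] at hcard; omega
    have := Nat.le_of_dvd (by omega) hdvd
    have := hlow g hg1
    have := conj_card_le g hg
    omega
  · have hlow : ∀ g : Equiv.Perm (Fin 4), g ≠ 1 →
        4 ≤ (insert 1 (Finset.univ.image fun a => a * g * a⁻¹)).card ∧
          (g ^ 3 = 1 → 7 ≤ (insert 1 (Finset.univ.image fun a => a * g * a⁻¹)).card) := by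
      decide +kernel
    have hH6 : Nat.card H = 6 := by simp [Nat.factorial] at hcard; omega
    rw [hH6] at hdvd
    have hle := Nat.le_of_dvd (by omega) hdvd
    have hge := (hlow g hg1).1.trans (conj_card_le g hg)
    have h3 : 3 ∣ Nat.card H.normalCore := by
      interval_cases Nat.card H.normalCore <;> omega
    have : Fact (Nat.Prime 3) := ⟨Nat.prime_three⟩
    obtain ⟨k, hk⟩ := exists_prime_orderOf_dvd_card' 3 h3
    have hk1 : (k : Equiv.Perm (Fin 4)) ≠ 1 := fun h => by
      rw [← Subgroup.orderOf_coe, h, orderOf_one] at hk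
      omega
    have hk3 : (k : Equiv.Perm (Fin 4)) ^ 3 = 1 := by
      rw [← hk, ← Subgroup.orderOf_coe, pow_orderOf_eq_one]
    have := ((hlow k hk1).2 hk3).trans (conj_card_le k k.2)
    omega

/-- If `G` acts on a finite set `X` through all of `Equiv.Perm X`, then a subgroup of `G` of index
`|X|` that is intransitive on `X` has a fixed point. -/
theorem exists_fixed_point_of_stable_set {G X : Type*} [Group G] [MulAction G X] [Finite X]
    (hsurj : Function.Surjective (toPermHom G X)) {H : Subgroup G} (hH : H.index = Nat.card X)
    {S : Set X} (hS : S.Nonempty) (hS' : Sᶜ.Nonempty) (hstab : ∀ h ∈ H, h • S = S) :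
    ∃ x : X, ∀ h ∈ H, h • x = x := by
  classical
  have key (T : Set X) (hT : ∀ h ∈ H, h • T = T) (hcard : T.ncard = 1) :
      ∃ x : X, ∀ h ∈ H, h • x = x := by
    obtain ⟨x, rfl⟩ := Set.ncard_eq_one.1 hcard
    exact ⟨x, fun h hh => by simpa using hT h hh⟩
  by_cases h1 : S.ncard = 1
  · exact key S hstab h1
  by_cases h2 : Sᶜ.ncard = 1
  · exact key Sᶜ (fun h hh => by rw [Set.smul_set_compl, hstab h hh]) h2
  exfalso
  have hpos := (Set.ncard_pos (Set.toFinite S)).2 hS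
  have hpos' := (Set.ncard_pos (Set.toFinite Sᶜ)).2 hS'
  have hadd := Set.ncard_add_ncard_compl S
  have hlt := Nat.add_lt_choose_add (a := S.ncard) (b := Sᶜ.ncard) (by omega) (by omega)
  rw [hadd] at hlt
  have : Fintype X := Fintype.ofFinite X
  let s : Set.powersetCard X S.ncard := ⟨S.toFinset, (Set.ncard_eq_toFinset_card' S).symm⟩
  have htrans : IsPretransitive G (Set.powersetCard X S.ncard) := by
    have := Set.powersetCard.isPretransitive (α := X) (n := S.ncard)
    refine ⟨fun t t' => ?_⟩
    obtain ⟨σ, hσ⟩ := exists_smul_eq (Equiv.Perm X) t t'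
    obtain ⟨g, rfl⟩ := hsurj σ
    exact ⟨g, hσ⟩
  have hle : H ≤ stabilizer G s := fun h hh => by
    rw [Set.powersetCard.stabilizer_coe, mem_stabilizer_iff]
    have hs : ((s : Finset X) : Set X) = S := Set.coe_toFinset S
    exact hs.symm ▸ hstab h hh
  have hindex : (stabilizer G s).index = (Nat.card X).choose S.ncard := by
    rw [index_stabilizer_of_transitive, Set.powersetCard.card]
  have : H.index ≠ 0 := by omega
  have := Nat.le_of_dvd (by omega) (Subgroup.index_dvd_of_le hle)
  omega


/-- If two subgroups `H₁, H₂` of `Sₙ` of index `n` have isomorphic rational permutation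
representations `ℚ[Sₙ/H₁] ≅ ℚ[Sₙ/H₂]`, then `H₁` and `H₂` are conjugate in `Sₙ`. -/
theorem conjugate_of_iso_permutation_representation (n : ℕ) (hn : 0 < n)
    (H₁ H₂ : Subgroup (Equiv.Perm (Fin n)))
    (h₁ : H₁.index = n) (h₂ : H₂.index = n)
    (hiso : Nonempty (Rep.ofMulAction ℚ (Equiv.Perm (Fin n)) (Equiv.Perm (Fin n) ⧸ H₁) ≅
      Rep.ofMulAction ℚ (Equiv.Perm (Fin n)) (Equiv.Perm (Fin n) ⧸ H₂))) :
    ∃ g : Equiv.Perm (Fin n), H₂ = Subgroup.map (MulAut.conj g).toMonoidHom H₁ := by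
  rcases eq_or_ne H₁ ⊤ with rfl | htop
  · have : H₂ = ⊤ := Subgroup.index_eq_one.1 (by rw [h₂, ← h₁, Subgroup.index_top])
    exact ⟨1, by simp [this]⟩
  have hcard : Nat.card (Equiv.Perm (Fin n) ⧸ H₂) = n := h₂
  have hinj : Function.Injective
      (toPermHom (Equiv.Perm (Fin n)) (Equiv.Perm (Fin n) ⧸ H₂)) := by
    rw [← MonoidHom.ker_eq_bot_iff, ← Subgroup.normalCore_eq_ker]
    exact normalCore_eq_bot_of_index_eq h₂
  have hsurj := ((Nat.bijective_iff_injective_and_card _).2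
    ⟨hinj, by rw [Nat.card_perm, Nat.card_perm, hcard, Nat.card_fin]⟩).surjective
  obtain ⟨e⟩ := hiso
  obtain ⟨S, hS, hS', hstab⟩ := exists_stable_set_of_iso htop e
  obtain ⟨x, hx⟩ := exists_fixed_point_of_stable_set hsurj (h₁.trans hcard.symm) hS hS' hstab
  obtain ⟨g, rfl⟩ := QuotientGroup.mk_surjective x
  have hle : Subgroup.map (MulAut.conj g⁻¹).toMonoidHom H₁ ≤ H₂ := by
    rintro _ ⟨h, hh, rfl⟩
    have := hx h hh
    rw [MulAction.Quotient.smul_coe, eq_comm, QuotientGroup.eq] at this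
    simpa [mul_assoc] using this
  refine ⟨g⁻¹, (eq_of_le_of_not_lt hle fun hlt => ?_).symm⟩
  have := Subgroup.index_strictAnti hlt
  have hmap : (Subgroup.map (MulAut.conj g⁻¹).toMonoidHom H₁).index = H₁.index :=
    Subgroup.index_map_equiv H₁ (MulAut.conj g⁻¹)
  omega
end
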